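/- arXiv:1002.2674 — 3 statements merged into one kernel-verified Lean document; each statement's English description precedes it below -/
import Mathlib

section
/- Let m ≥ 1, let θ ∈ k^× have order m, let q ∈ ℤ, and set g = gcd(q, m) (with the convention gcd(0,m) = m). Let R_1 = k[t_1^{±1}] be the Laurent polynomial algebra in one variable over k. Then for any integer s with s·(q/g) ≡ 1 (mod m/g), the loop algebra L_m(Mat_m(R_1), P_m(t_1)^q, θ) is isomorphic as a k-algebra to the matrix algebra Mat_g(Q(θ^{gs})) over the quantum torus Q(θ^{gs}). (When q = 0 the congruence condition is vacuous and the right-hand side is Mat_m(Q(1)).) -/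
open scoped TensorProduct

noncomputable section

/-- Conjugation `Ad(u) : x ↦ u x u⁻¹` by a unit `u`, as a `k`-algebra automorphism. -/
def Ad {k A : Type*} [CommSemiring k] [Ring A] [Algebra k A] (u : Aˣ) : A ≃ₐ[k] A where
  toFun x := u * x * ↑u⁻¹
  invFun x := ↑u⁻¹ * x * u
  left_inv x := by simp [mul_assoc]
  right_inv x := by simp [mul_assoc]
  map_mul' x y := by simp [mul_assoc]
  map_add' x y := by simp [mul_add, add_mul]
  commutes' r := by
    show (u : A) * algebraMap k A r * ↑u⁻¹ = algebraMap k A r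
    rw [← Algebra.commutes r (u : A)]
    simp [mul_assoc]

variable {F : Type*} [CommRing F]

/-- `d_m(u) = diag(1, u, …, u^{m-1})`, as a unit of the matrix algebra. -/
def dUnit (m : ℕ) (u : Fˣ) : (Matrix (Fin m) (Fin m) F)ˣ where
  val := Matrix.diagonal fun i => (u : F) ^ (i : ℕ)
  inv := Matrix.diagonal fun i => ((u⁻¹ : Fˣ) : F) ^ (i : ℕ)
  val_inv := by
    ext i j
    simp only [Matrix.diagonal_mul_diagonal, Matrix.diagonal_apply, Matrix.one_apply,
      ← Units.val_pow_eq_pow_val, ← Units.val_mul, inv_pow]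
    split
    · simp
    · rfl
  inv_val := by
    ext i j
    simp only [Matrix.diagonal_mul_diagonal, Matrix.diagonal_apply, Matrix.one_apply,
      ← Units.val_pow_eq_pow_val, ← Units.val_mul, inv_pow]
    split
    · simp
    · rfl

/-- `p_m(u)`: the matrix with `(1,m)`-entry `u`, `(i+1,i)`-entries `1`, and all other
entries `0` (indices taken cyclically via `Fin m`), as a unit of the matrix algebra. -/
def pUnit (m : ℕ) [NeZero m] (u : Fˣ) : (Matrix (Fin m) (Fin m) F)ˣ where
  val := Matrix.of fun i j => if i = j + 1 then (if (j : ℕ) = m - 1 then (u : F) else 1) else 0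
  inv := Matrix.of fun i j =>
    if j = i + 1 then (if (i : ℕ) = m - 1 then ((u⁻¹ : Fˣ) : F) else 1) else 0
  val_inv := by
    ext i j
    rw [Matrix.mul_apply, Finset.sum_eq_single (i - 1)]
    · by_cases hij : j = i
      · subst hij
        by_cases hlast : ((j - 1 : Fin m) : ℕ) = m - 1
        · simp [sub_add_cancel, hlast, Matrix.one_apply]
        · simp [sub_add_cancel, hlast, Matrix.one_apply]
      · have h1 : ¬(j = i - 1 + 1) := by rw [sub_add_cancel]; exact hij
        simp [sub_add_cancel, h1, Matrix.one_apply, hij, Ne.symm hij]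
    · intro l _ hl
      have h2 : ¬(i = l + 1) := fun h => hl (by rw [h, add_sub_cancel_right])
      simp [h2]
    · intro h
      exact absurd (Finset.mem_univ _) h
  inv_val := by
    ext i j
    rw [Matrix.mul_apply, Finset.sum_eq_single (i + 1)]
    · by_cases hij : i = j
      · subst hij
        by_cases hlast : (i : ℕ) = m - 1
        · simp [hlast, Matrix.one_apply]
        · simp [hlast, Matrix.one_apply]
      · have h1 : ¬(i + 1 = j + 1) := fun h => hij (add_right_cancel h)
        simp [h1, Matrix.one_apply, hij]
    · intro l _ hl
      simp [hl]
    · intro h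
      exact absurd (Finset.mem_univ _) h

/-- The defining relations of the quantum torus `Q(θ)`:  `x_1 x_1⁻¹ = x_1⁻¹ x_1 = 1`,
`x_2 x_2⁻¹ = x_2⁻¹ x_2 = 1` and `x_1 x_2 = θ x_2 x_1`, where the four generators
`x_1, x_2, x_1⁻¹, x_2⁻¹` are the images of the indices `0, 1, 2, 3`. -/
inductive QRel (k : Type*) [Field k] (θ : k) :
    FreeAlgebra k (Fin 4) → FreeAlgebra k (Fin 4) → Prop
  | inv_one : QRel k θ (FreeAlgebra.ι k 0 * FreeAlgebra.ι k 2) 1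
  | inv_one' : QRel k θ (FreeAlgebra.ι k 2 * FreeAlgebra.ι k 0) 1
  | inv_two : QRel k θ (FreeAlgebra.ι k 1 * FreeAlgebra.ι k 3) 1
  | inv_two' : QRel k θ (FreeAlgebra.ι k 3 * FreeAlgebra.ι k 1) 1
  | q_comm : QRel k θ (FreeAlgebra.ι k 0 * FreeAlgebra.ι k 1)
      (algebraMap k (FreeAlgebra k (Fin 4)) θ * (FreeAlgebra.ι k 1 * FreeAlgebra.ι k 0))

/-- The quantum torus `Q(θ)` determined by `θ ∈ k^×`. -/
abbrev QT (k : Type*) [Field k] (θ : k) : Type _ := RingQuot (QRel k θ)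

/-- The distinguished generators of `Q(θ)`:  `qx k θ 0 = x_1`, `qx k θ 1 = x_2`,
`qx k θ 2 = x_1⁻¹`, `qx k θ 3 = x_2⁻¹`. -/
def qx (k : Type*) [Field k] (θ : k) (i : Fin 4) : QT k θ :=
  RingQuot.mkAlgHom k (QRel k θ) (FreeAlgebra.ι k i)


/-- The variable `t_1`, as a unit of the Laurent polynomial ring `R_1 = k[t_1^{±1}]`. -/
def tUnit (k : Type*) [Field k] : (LaurentPolynomial k)ˣ where
  val := LaurentPolynomial.T 1
  inv := LaurentPolynomial.T (-1)
  val_inv := by rw [← LaurentPolynomial.T_add]; norm_num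
  inv_val := by rw [← LaurentPolynomial.T_add]; norm_num

/-- The generating set `{a ⊗ z^j : a ∈ A^j}` of the (associative) loop algebra
`L_m(A, τ, θ)`. -/
def lGens (k : Type*) [Field k] (A : Type*) [Ring A] [Algebra k A]
    (τ : A ≃ₐ[k] A) (θ : kˣ) : Set (A ⊗[k] LaurentPolynomial k) :=
  {w | ∃ (j : ℤ) (a : A), τ a = ((θ ^ j : kˣ) : k) • a ∧
    w = a ⊗ₜ[k] LaurentPolynomial.T j}

/-- The (associative) loop algebra `L_m(A, τ, θ) = ⨁_j A^j ⊗ z^j`, as a unital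
subalgebra of `A ⊗ k[z^{±1}]`. -/
def loopAssoc (k : Type*) [Field k] (A : Type*) [Ring A] [Algebra k A]
    (τ : A ≃ₐ[k] A) (θ : kˣ) : Subalgebra k (A ⊗[k] LaurentPolynomial k) :=
  Algebra.adjoin k (lGens k A τ θ)


section Monomials

variable {k M : Type*} [Field k] [Ring M] [Algebra k M]

theorem zpow_mul_zpow_of_mul_eq {G : Type*} [Group G] {x y c : G} (hx : Commute c x)
    (hy : Commute c y) (h : y * x = c * (x * y)) (a b : ℤ) :
    y ^ b * x ^ a = c ^ (a * b) * (x ^ a * y ^ b) := by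
  have h1 : SemiconjBy y x (c * x) := by
    rw [SemiconjBy, h, mul_assoc]
  have h2 : y * x ^ a = c ^ a * x ^ a * y := by
    rw [← hx.mul_zpow]; exact h1.zpow_right a
  have h3 : SemiconjBy (x ^ a) (c ^ a * y) y := by
    rw [SemiconjBy, h2, ← mul_assoc, (hx.zpow_zpow a a).eq]
  have h4 := h3.zpow_right b
  rw [(hy.zpow_left a).mul_zpow, ← zpow_mul] at h4
  rw [← h4.eq, ← mul_assoc, ← mul_assoc, (hx.zpow_zpow (a * b) a).eq]

theorem units_zpow_mul_zpow {x y : Mˣ} {c : kˣ}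
    (h : (y : M) * (x : M) = (c : k) • ((x : M) * (y : M))) (a b : ℤ) :
    (↑(y ^ b) * ↑(x ^ a) : M) = ((c ^ (a * b) : kˣ) : k) • (↑(x ^ a) * ↑(y ^ b) : M) := by
  have hc : ∀ z : Mˣ, Commute (Units.map (algebraMap k M : k →* M) c) z := fun z =>
    Units.ext (by simpa using Algebra.commutes (c : k) (z : M))
  have key := zpow_mul_zpow_of_mul_eq (hc x) (hc y)
    (Units.ext (by simpa [Algebra.smul_def] using h)) a b
  have := congrArg (Units.val) key
  rw [← map_zpow] at this
  rw [Algebra.smul_def]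
  exact this

theorem mem_span_zpow_of_mem_adjoin {x y : Mˣ} {c : kˣ}
    (h : (y : M) * (x : M) = (c : k) • ((x : M) * (y : M))) {z : M}
    (hz : z ∈ Algebra.adjoin k ({(x : M), ↑x⁻¹, (y : M), ↑y⁻¹} : Set M)) :
    z ∈ Submodule.span k (Set.range fun ab : ℤ × ℤ => (↑(x ^ ab.1) * ↑(y ^ ab.2) : M)) := by
  induction hz using Algebra.adjoin_induction with
  | mem z hz =>
    apply Submodule.subset_span
    rcases hz with rfl | rfl | rfl | rfl
    exacts [⟨(1, 0), by simp⟩, ⟨(-1, 0), by simp⟩, ⟨(0, 1), by simp⟩, ⟨(0, -1), by simp⟩]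
  | algebraMap r =>
    rw [Algebra.algebraMap_eq_smul_one]
    exact Submodule.smul_mem _ _ (Submodule.subset_span ⟨(0, 0), by simp⟩)
  | add z w _ _ hz hw => exact add_mem hz hw
  | mul z w _ _ hz hw =>
    have := Submodule.mul_mem_mul hz hw
    rw [Submodule.span_mul_span] at this
    refine Submodule.span_le.2 ?_ this
    rintro _ ⟨_, ⟨⟨a, b⟩, rfl⟩, _, ⟨⟨a', b'⟩, rfl⟩, rfl⟩
    have key : (↑(x ^ a) * ↑(y ^ b)) * (↑(x ^ a') * ↑(y ^ b')) =
        ((c ^ (a' * b) : kˣ) : k) • (↑(x ^ (a + a')) * ↑(y ^ (b + b')) : M) := by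
      calc (↑(x ^ a) * ↑(y ^ b)) * (↑(x ^ a') * ↑(y ^ b'))
          = (↑(x ^ a) : M) * (↑(y ^ b) * ↑(x ^ a')) * ↑(y ^ b') := by simp only [mul_assoc]
        _ = _ := by
          rw [units_zpow_mul_zpow h]
          simp [zpow_add, mul_assoc]
    simp only [SetLike.mem_coe]
    rw [key]
    exact Submodule.smul_mem _ _ (Submodule.subset_span ⟨(a + a', b + b'), rfl⟩)

end Monomials

section QuantumTorus

variable {k M : Type*} [Field k] [Ring M] [Algebra k M]

/-- The generator `x_1` of the quantum torus, as a unit. -/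
def qUnitOne (k : Type*) [Field k] (θ : k) : (QT k θ)ˣ where
  val := qx k θ 0
  inv := qx k θ 2
  val_inv := by
    simpa [qx] using RingQuot.mkAlgHom_rel k (QRel.inv_one (k := k) (θ := θ))
  inv_val := by
    simpa [qx] using RingQuot.mkAlgHom_rel k (QRel.inv_one' (k := k) (θ := θ))

/-- The generator `x_2` of the quantum torus, as a unit. -/
def qUnitTwo (k : Type*) [Field k] (θ : k) : (QT k θ)ˣ where
  val := qx k θ 1
  inv := qx k θ 3
  val_inv := by
    simpa [qx] using RingQuot.mkAlgHom_rel k (QRel.inv_two (k := k) (θ := θ))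
  inv_val := by
    simpa [qx] using RingQuot.mkAlgHom_rel k (QRel.inv_two' (k := k) (θ := θ))

theorem qUnitOne_mul_qUnitTwo (θ : k) :
    (qUnitOne k θ * qUnitTwo k θ : QT k θ) = θ • (qUnitTwo k θ * qUnitOne k θ : QT k θ) := by
  have := RingQuot.mkAlgHom_rel k (QRel.q_comm (k := k) (θ := θ))
  rw [map_mul, map_mul, map_mul, AlgHom.commutes, ← Algebra.smul_def] at this
  exact this

theorem adjoin_qUnit_eq_top (θ : k) :
    Algebra.adjoin k ({(qUnitOne k θ : QT k θ), ↑(qUnitOne k θ)⁻¹, (qUnitTwo k θ : QT k θ),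
      ↑(qUnitTwo k θ)⁻¹} : Set (QT k θ)) = ⊤ := by
  rw [eq_top_iff]
  rintro z -
  obtain ⟨w, rfl⟩ := RingQuot.mkAlgHom_surjective k (QRel k θ) z
  induction w using FreeAlgebra.induction with
  | grade0 r => rw [AlgHom.commutes]; exact Subalgebra.algebraMap_mem _ _
  | grade1 i =>
    apply Algebra.subset_adjoin
    fin_cases i
    exacts [Or.inl rfl, Or.inr (Or.inr (Or.inl rfl)), Or.inr (Or.inl rfl),
      Or.inr (Or.inr (Or.inr rfl))]
  | mul a b ha hb => rw [map_mul]; exact mul_mem ha hb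
  | add a b ha hb => rw [map_add]; exact add_mem ha hb

theorem mem_span_qUnit (θ : kˣ) (z : QT k (θ : k)) :
    z ∈ Submodule.span k (Set.range fun ab : ℤ × ℤ =>
      (↑(qUnitOne k (θ : k) ^ ab.1) * ↑(qUnitTwo k (θ : k) ^ ab.2) : QT k (θ : k))) := by
  refine mem_span_zpow_of_mem_adjoin (c := θ⁻¹) ?_ (by rw [adjoin_qUnit_eq_top]; trivial)
  rw [qUnitOne_mul_qUnitTwo, smul_smul]
  simp

/-- The homomorphism from the quantum torus determined by a pair of units `x y = θ y x`. -/
def qLift {θ : k} (x y : Mˣ) (h : (x : M) * (y : M) = θ • ((y : M) * (x : M))) :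
    QT k θ →ₐ[k] M :=
  RingQuot.liftAlgHom k ⟨FreeAlgebra.lift k ![(x : M), y, ↑x⁻¹, ↑y⁻¹], by
    intro a b hab
    cases hab <;> simp [h, Algebra.smul_def]⟩

theorem qLift_zpow_mul_zpow {θ : k} (x y : Mˣ)
    (h : (x : M) * (y : M) = θ • ((y : M) * (x : M))) (a b : ℤ) :
    qLift x y h (↑(qUnitOne k θ ^ a) * ↑(qUnitTwo k θ ^ b)) = ↑(x ^ a) * ↑(y ^ b) := by
  have h1 : Units.map (qLift x y h : QT k θ →* M) (qUnitOne k θ) = x :=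
    Units.ext (by simp [qLift, qUnitOne, qx])
  have h2 : Units.map (qLift x y h : QT k θ →* M) (qUnitTwo k θ) = y :=
    Units.ext (by simp [qLift, qUnitTwo, qx])
  have h1a := map_zpow (Units.map (qLift x y h : QT k θ →* M)) (qUnitOne k θ) a
  have h2b := map_zpow (Units.map (qLift x y h : QT k θ →* M)) (qUnitTwo k θ) b
  rw [h1] at h1a
  rw [h2] at h2b
  rw [map_mul, ← h1a, ← h2b]
  rfl

end QuantumTorus

section MatrixUnits

variable {k B C : Type*} [Field k] [Ring B] [Algebra k B] [Ring C] [Algebra k C]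
  {ι : Type*} [Fintype ι] [DecidableEq ι]

/-- The homomorphism `N ↦ ∑ u_i φ(N_{ij}) v_j` from a matrix algebra determined by a system of
matrix units `u_i v_j` and a homomorphism `φ` commuting with the idempotent `v_i u_i = e`. -/
def matrixUnitLift (φ : B →ₐ[k] C) (u v : ι → C) (e : C)
    (hvu : ∀ i j, v i * u j = if i = j then e else 0) (huv : ∑ i, u i * v i = 1)
    (hue : ∀ i, u i * e = u i) (he : ∀ b, Commute e (φ b)) : Matrix ι ι B →ₐ[k] C :=
  AlgHom.ofLinearMap
    { toFun := fun N => ∑ i, ∑ j, u i * φ (N i j) * v j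
      map_add' := fun N N' => by
        simp [mul_add, add_mul, Finset.sum_add_distrib]
      map_smul' := fun c N => by
        simp [Finset.smul_sum] }
    (by
      rw [← huv]
      refine Finset.sum_congr rfl fun i _ => ?_
      rw [Finset.sum_eq_single i]
      · simp
      · intro j _ hj
        simp [Matrix.one_apply_ne hj.symm]
      · simp)
    (fun N N' => by
      have key : ∀ i j l, u i * φ (N i j) * v j * (u j * φ (N' j l) * v l) =
          u i * (φ (N i j) * φ (N' j l)) * v l := by
        intro i j l
        calc u i * φ (N i j) * v j * (u j * φ (N' j l) * v l)
            = u i * (φ (N i j) * (v j * u j)) * φ (N' j l) * v l := by simp only [mul_assoc]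
          _ = u i * (φ (N i j) * φ (N' j l)) * v l := by
            rw [hvu, if_pos rfl, ← (he _).eq, ← mul_assoc, hue]
            simp only [mul_assoc]
      have key' : ∀ i j j' l, j ≠ j' →
          u i * φ (N i j) * v j * (u j' * φ (N' j' l) * v l) = 0 := by
        intro i j j' l hj
        calc u i * φ (N i j) * v j * (u j' * φ (N' j' l) * v l)
            = u i * φ (N i j) * (v j * u j') * φ (N' j' l) * v l := by simp only [mul_assoc]
          _ = 0 := by rw [hvu, if_neg hj]; simp
      change ∑ i, ∑ l, u i * φ ((N * N') i l) * v l =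
        (∑ i, ∑ j, u i * φ (N i j) * v j) * ∑ j, ∑ l, u j * φ (N' j l) * v l
      rw [Finset.sum_mul]
      refine Finset.sum_congr rfl fun i _ => ?_
      rw [Finset.sum_mul]
      trans ∑ j, ∑ l, u i * (φ (N i j) * φ (N' j l)) * v l
      · rw [Finset.sum_comm]
        refine Finset.sum_congr rfl fun l _ => ?_
        rw [Matrix.mul_apply, map_sum, Finset.mul_sum, Finset.sum_mul]
        simp only [map_mul]
      · refine Finset.sum_congr rfl fun j _ => ?_
        rw [Finset.mul_sum]
        symm
        rw [Finset.sum_eq_single j]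
        · rw [Finset.mul_sum]
          exact Finset.sum_congr rfl fun l _ => key i j l
        · intro j' _ hj'
          rw [Finset.mul_sum]
          exact Finset.sum_eq_zero fun l _ => key' i j j' l hj'.symm
        · simp)

variable {φ : B →ₐ[k] C} {u v : ι → C} {e : C}
    {hvu : ∀ i j, v i * u j = if i = j then e else 0} {huv : ∑ i, u i * v i = 1}
    {hue : ∀ i, u i * e = u i} {he : ∀ b, Commute e (φ b)}

theorem matrixUnitLift_apply (N : Matrix ι ι B) :
    matrixUnitLift φ u v e hvu huv hue he N = ∑ i, ∑ j, u i * φ (N i j) * v j := rfl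

theorem matrixUnitLift_single (i j : ι) (b : B) :
    matrixUnitLift φ u v e hvu huv hue he (Matrix.single i j b) = u i * φ b * v j := by
  rw [matrixUnitLift_apply, Finset.sum_eq_single i, Finset.sum_eq_single j]
  · simp
  · intro j' _ hj'
    simp [hj'.symm]
  · simp
  · intro i' _ hi'
    exact Finset.sum_eq_zero fun j' _ => by simp [hi'.symm]
  · simp

theorem matrixUnitLift_injective (hinj : ∀ b, φ b * e = 0 → b = 0) :
    Function.Injective (matrixUnitLift φ u v e hvu huv hue he) := by
  rw [injective_iff_map_eq_zero]
  intro N hN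
  ext i j
  have hee : e * e = e := by
    have := congrArg (v i * ·) (hue i)
    simpa [← mul_assoc, hvu] using this
  have h : v i * (∑ i', ∑ j', u i' * φ (N i' j') * v j') * u j = φ (N i j) * e := by
    simp only [Finset.mul_sum, Finset.sum_mul]
    rw [Finset.sum_eq_single i, Finset.sum_eq_single j]
    · calc v i * (u i * φ (N i j) * v j) * u j = (v i * u i) * φ (N i j) * (v j * u j) := by
            simp only [mul_assoc]
        _ = φ (N i j) * e := by
            rw [hvu, hvu, if_pos rfl, if_pos rfl, (he _).eq, mul_assoc, hee]
    · intro j' _ hj'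
      calc v i * (u i * φ (N i j') * v j') * u j = (v i * u i) * φ (N i j') * (v j' * u j) := by
            simp only [mul_assoc]
        _ = 0 := by rw [hvu j' j, if_neg hj', mul_zero]
    · simp
    · intro i' _ hi'
      refine Finset.sum_eq_zero fun j' _ => ?_
      calc v i * (u i' * φ (N i' j') * v j') * u j
          = (v i * u i') * φ (N i' j') * (v j' * u j) := by simp only [mul_assoc]
        _ = 0 := by rw [hvu i i', if_neg hi'.symm, zero_mul, zero_mul]
    · simp
  rw [← matrixUnitLift_apply (hvu := hvu) (huv := huv) (hue := hue) (he := he), hN] at h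
  exact hinj _ (by simpa using h.symm)

end MatrixUnits

section Averaging

variable {k M : Type*} [Field k] [Ring M] [Algebra k M]

theorem geom_sum_eq_zero_of_pow_eq_one {ζ : k} {n : ℕ} (h : ζ ^ n = 1) (h1 : ζ ≠ 1) :
    ∑ l ∈ Finset.range n, ζ ^ l = 0 := by
  have := geom_sum_mul ζ n
  rw [h, sub_self] at this
  exact (mul_eq_zero.1 this).resolve_right (sub_ne_zero.2 h1)

/-- The idempotent `g⁻¹ ∑_{c<g} x^c` projecting to the fixed space of an element with `x^g = 1`. -/
def powAverage (k : Type*) {M : Type*} [Field k] [Ring M] [Algebra k M] (g : ℕ) (x : M) : M :=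
  (g : k)⁻¹ • ∑ c ∈ Finset.range g, x ^ c

theorem powAverage_mul_self {g : ℕ} {x : M} (hx : x ^ g = 1) :
    powAverage k g x * x = powAverage k g x := by
  have := geom_sum_mul x g
  rw [hx, sub_self, mul_sub, mul_one, sub_eq_zero] at this
  rw [powAverage, smul_mul_assoc, this]

theorem Commute.powAverage_left {g : ℕ} {x y : M} (h : Commute x y) :
    Commute (powAverage k g x) y :=
  (Commute.sum_left _ _ _ fun c _ => h.pow_left c).smul_left _

theorem self_mul_powAverage {g : ℕ} {x : M} (hx : x ^ g = 1) :
    x * powAverage k g x = powAverage k g x := by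
  rw [← (Commute.powAverage_left (Commute.refl x)).eq, powAverage_mul_self hx]

theorem pow_mul_powAverage {g : ℕ} {x : M} (hx : x ^ g = 1) (n : ℕ) :
    x ^ n * powAverage k g x = powAverage k g x := by
  induction n with
  | zero => simp
  | succ n ih => rw [pow_succ, mul_assoc, self_mul_powAverage hx, ih]

theorem powAverage_isIdempotentElem [CharZero k] {g : ℕ} (hg : g ≠ 0) {x : M} (hx : x ^ g = 1) :
    powAverage k g x * powAverage k g x = powAverage k g x := by
  conv_lhs => enter [1]; rw [powAverage]
  rw [smul_mul_assoc, Finset.sum_mul, Finset.sum_congr rfl fun c _ => pow_mul_powAverage hx c,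
    Finset.sum_const, Finset.card_range, ← Nat.cast_smul_eq_nsmul k, smul_smul,
    inv_mul_cancel₀ (Nat.cast_ne_zero.2 hg), one_smul]

theorem powAverage_mul_zpow_mul_powAverage {g : ℕ} {x p : Mˣ} {ω : kˣ} (hx : x ^ g = 1)
    (h : (x : M) * (p : M) = (ω : k) • ((p : M) * (x : M))) {i : ℤ} (hi : ω ^ i ≠ 1) :
    powAverage k g (x : M) * ↑(p ^ i) * powAverage k g (x : M) = 0 := by
  have hx' : (x : M) ^ g = 1 := by rw [← Units.val_pow_eq_pow_val, hx, Units.val_one]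
  set e := powAverage k g (x : M) with he
  have h1 : e * ↑(p ^ i) * e = ((ω ^ i : kˣ) : k) • (e * ↑(p ^ i) * e) := by
    calc e * ↑(p ^ i) * e = e * (x * ↑(p ^ i)) * e := by
          rw [← mul_assoc e (x : M), he, powAverage_mul_self hx']
      _ = ((ω ^ i : kˣ) : k) • (e * ↑(p ^ i) * (x * e)) := by
          have := units_zpow_mul_zpow h i 1
          rw [zpow_one, mul_one] at this
          rw [this]
          simp [mul_assoc]
      _ = _ := by rw [he, self_mul_powAverage hx']
  have h2 : (((ω ^ i : kˣ) : k) - 1) • (e * ↑(p ^ i) * e) = 0 := by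
    rw [sub_smul, ← h1, one_smul, sub_self]
  refine (smul_eq_zero.1 h2).resolve_left fun h0 => hi (Units.ext ?_)
  rw [sub_eq_zero.1 h0, Units.val_one]

theorem sum_conj_powAverage [CharZero k] {g : ℕ} (hg : g ≠ 0) {x p : Mˣ} {ω : kˣ}
    (h : (x : M) * (p : M) = (ω : k) • ((p : M) * (x : M))) (hω : orderOf ω = g) :
    ∑ i ∈ Finset.range g, ↑(p ^ (i : ℤ)) * powAverage k g (x : M) * ↑(p ^ (-(i : ℤ))) = 1 := by
  have hc : ∀ i c : ℕ, (↑(p ^ (i : ℤ)) * (x : M) ^ c * ↑(p ^ (-(i : ℤ))) : M) =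
      ((ω⁻¹ ^ c : kˣ) : k) ^ i • (x : M) ^ c := by
    intro i c
    have := units_zpow_mul_zpow h (-(i : ℤ)) (c : ℤ)
    rw [mul_assoc, ← Units.val_pow_eq_pow_val, ← zpow_natCast x c, this, mul_smul_comm,
      ← mul_assoc, ← Units.val_mul, ← zpow_add, add_neg_cancel, zpow_zero, Units.val_one, one_mul,
      ← Units.val_pow_eq_pow_val, ← pow_mul, inv_pow, ← zpow_natCast, ← zpow_neg]
    congr 4
    push_cast
    ring
  simp only [powAverage, mul_smul_comm, smul_mul_assoc, Finset.mul_sum, Finset.sum_mul, hc]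
  rw [← Finset.smul_sum, Finset.sum_comm, Finset.sum_eq_single 0]
  · simp [← Nat.cast_smul_eq_nsmul k, smul_smul, hg]
  · intro c hc hc0
    rw [← Finset.sum_smul, geom_sum_eq_zero_of_pow_eq_one, zero_smul]
    · rw [← Units.val_pow_eq_pow_val, ← pow_mul, mul_comm, pow_mul, inv_pow, ← hω,
        pow_orderOf_eq_one]
      simp
    · rw [Ne, Units.val_eq_one, inv_pow, inv_eq_one, ← orderOf_dvd_iff_pow_eq_one, hω]
      exact fun hd => hc0 (Nat.eq_zero_of_dvd_of_lt hd (Finset.mem_range.1 hc))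
  · intro h0
    exact absurd (Finset.mem_range.2 (Nat.pos_of_ne_zero hg)) h0

theorem map_mul_powAverage [CharZero k] {g : ℕ} (hg : g ≠ 0) {x : M} (τ : M →ₗ[k] k)
    (h : ∀ y, τ (y * x) = τ y) (y : M) : τ (y * powAverage k g x) = τ y := by
  have hp : ∀ c : ℕ, ∀ y, τ (y * x ^ c) = τ y := by
    intro c
    induction c with
    | zero => simp
    | succ c ih => intro y; rw [pow_succ, ← mul_assoc, h, ih]
  simp [powAverage, Finset.mul_sum, hp, hg]

end Averaging

section LoopAlgebra

variable {k M : Type*} [Field k] [Ring M] [Algebra k M]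

theorem Ad_zpow (p : Mˣ) (q : ℤ) : (Ad p : M ≃ₐ[k] M) ^ q = Ad (p ^ q) := by
  let f : Mˣ →* (M ≃ₐ[k] M) := MonoidHom.mk' Ad fun u v => by
    ext x
    simp [Ad, mul_assoc]
  exact (map_zpow f p q).symm

theorem tUnit_zpow (n : ℤ) : ((tUnit k ^ n : (LaurentPolynomial k)ˣ) : LaurentPolynomial k) =
    LaurentPolynomial.T n := by
  cases n with
  | ofNat n => simp [tUnit, LaurentPolynomial.T_pow]
  | negSucc n =>
    rw [zpow_negSucc, ← inv_pow, Units.val_pow_eq_pow_val]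
    change LaurentPolynomial.T (-1) ^ (n + 1) = _
    rw [LaurentPolynomial.T_pow, Int.negSucc_eq]
    congr 1
    push_cast
    ring

/-- The coefficient of `T^n`, as a linear functional on Laurent polynomials. -/
def laurentCoeff (k : Type*) [Field k] (n : ℤ) : LaurentPolynomial k →ₗ[k] k where
  toFun f := f.coeff n
  map_add' f g := by simp
  map_smul' c f := by simp

theorem laurentCoeff_T (n j : ℤ) :
    laurentCoeff k n (LaurentPolynomial.T j) = if j = n then 1 else 0 :=
  LaurentPolynomial.T_apply n j

/-- A pair of units `d p = θ p d` with `d^m = 1` generating an algebra, and a functional `τ`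
detecting the powers of `p`. -/
structure IsCyclicPair (θ : kˣ) (m : ℕ) (p d : Mˣ) (τ : M →ₗ[k] k) : Prop where
  mul_eq : (d : M) * (p : M) = (θ : k) • ((p : M) * (d : M))
  pow_eq_one : d ^ m = 1
  adjoin_eq_top : Algebra.adjoin k ({(p : M), ↑p⁻¹, (d : M), ↑d⁻¹} : Set M) = ⊤
  map_mul : ∀ x, τ (x * d) = τ x
  map_zpow : ∀ n : ℤ, τ ↑(p ^ n) = if n = 0 then 1 else 0

namespace IsCyclicPair

open TensorProduct LaurentPolynomial

variable {θ : kˣ} {m : ℕ} {p d : Mˣ} {τ : M →ₗ[k] k}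

theorem zpow_mul_zpow (h : IsCyclicPair θ m p d τ) (a b : ℤ) :
    (↑(d ^ b) * ↑(p ^ a) : M) = ((θ ^ (a * b) : kˣ) : k) • (↑(p ^ a) * ↑(d ^ b) : M) :=
  units_zpow_mul_zpow h.mul_eq a b

theorem map_mul_zpow (h : IsCyclicPair θ m p d τ) (x : M) (b : ℤ) :
    τ (x * ↑(d ^ b)) = τ x := by
  induction b with
  | zero => simp
  | succ b ih => rw [zpow_add_one, Units.val_mul, ← mul_assoc, h.map_mul, ih]
  | pred b ih =>
    rw [← ih, ← h.map_mul, mul_assoc, ← Units.val_mul, ← zpow_add_one, sub_add_cancel]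

theorem Ad_zpow_apply (h : IsCyclicPair θ m p d τ) (q a b : ℤ) :
    ((Ad p : M ≃ₐ[k] M) ^ q) (↑(p ^ a) * ↑(d ^ b)) =
      ((θ ^ (-(q * b)) : kˣ) : k) • (↑(p ^ a) * ↑(d ^ b) : M) := by
  rw [Ad_zpow]
  change (↑(p ^ q) : M) * (↑(p ^ a) * ↑(d ^ b)) * ↑(p ^ q)⁻¹ = _
  rw [← zpow_neg, mul_assoc, mul_assoc, h.zpow_mul_zpow, mul_smul_comm, mul_smul_comm,
    ← mul_assoc, ← mul_assoc, ← Units.val_mul, ← Units.val_mul, neg_mul]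
  congr 4
  rw [← zpow_add, ← zpow_add]
  congr 1
  ring

variable (hord : orderOf θ = m)

include hord in
theorem tmul_mem_loopAssoc (h : IsCyclicPair θ m p d τ) {q a b j : ℤ}
    (hj : (m : ℤ) ∣ j + q * b) :
    (↑(p ^ a) * ↑(d ^ b) : M) ⊗ₜ[k] (T j : k[T;T⁻¹]) ∈ loopAssoc k M (Ad p ^ q) θ := by
  refine Algebra.subset_adjoin ⟨j, _, ?_, rfl⟩
  rw [h.Ad_zpow_apply]
  congr 2
  rw [← hord, orderOf_dvd_iff_zpow_eq_one, zpow_add, mul_eq_one_iff_eq_inv, ← zpow_neg] at hj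
  exact hj.symm

theorem _root_.AlgEquiv.pow_apply_of_apply_eq_smul (σ : M ≃ₐ[k] M) {c : k} {x : M}
    (h : σ x = c • x) (l : ℕ) : (σ ^ l) x = c ^ l • x := by
  induction l with
  | zero => simp
  | succ l ih => rw [pow_succ', AlgEquiv.mul_apply, ih, map_smul, h, smul_smul, pow_succ]

include hord in
theorem loopAssoc_le [CharZero k] (hm : m ≠ 0) (h : IsCyclicPair θ m p d τ) {q : ℤ}
    (S : Subalgebra k (M ⊗[k] k[T;T⁻¹]))
    (hS : ∀ a b j : ℤ, (m : ℤ) ∣ j + q * b →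
      (↑(p ^ a) * ↑(d ^ b) : M) ⊗ₜ[k] (T j : k[T;T⁻¹]) ∈ S) :
    loopAssoc k M (Ad p ^ q) θ ≤ S := by
  refine Algebra.adjoin_le ?_
  rintro _ ⟨j, x, hx, rfl⟩
  set σ : M ≃ₐ[k] M := Ad p ^ q
  let π : M →ₗ[k] M :=
    ∑ l ∈ Finset.range m, (((θ ^ (-j) : kˣ) : k) ^ l) • (σ ^ l).toLinearMap
  have hπ : ∀ (c : ℤ) (y : M), σ y = ((θ ^ c : kˣ) : k) • y →
      π y = (∑ l ∈ Finset.range m, ((θ ^ (c - j) : kˣ) : k) ^ l) • y := by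
    intro c y hy
    simp only [π, LinearMap.sum_apply, LinearMap.smul_apply, AlgEquiv.toLinearMap_apply,
      σ.pow_apply_of_apply_eq_smul hy, smul_smul, ← mul_pow, Finset.sum_smul]
    refine Finset.sum_congr rfl fun l _ => ?_
    rw [← Units.val_mul, ← zpow_add, neg_add_eq_sub]
  have hmem : ∀ y : M, π y ⊗ₜ[k] (T j : k[T;T⁻¹]) ∈ S := by
    intro y
    have hy : y ∈ Submodule.span k (Set.range fun ab : ℤ × ℤ =>
        (↑(p ^ ab.1) * ↑(d ^ ab.2) : M)) :=
      mem_span_zpow_of_mem_adjoin h.mul_eq (by rw [h.adjoin_eq_top]; trivial)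
    induction hy using Submodule.span_induction with
    | mem y hy =>
      obtain ⟨⟨a, b⟩, rfl⟩ := hy
      dsimp only
      rw [hπ _ _ (h.Ad_zpow_apply q a b), ← smul_tmul']
      by_cases hd : (m : ℤ) ∣ j + q * b
      · exact S.smul_mem (hS a b j hd) _
      · rw [geom_sum_eq_zero_of_pow_eq_one, zero_smul]
        · exact S.zero_mem
        · rw [← Units.val_pow_eq_pow_val, ← zpow_natCast, ← zpow_mul, mul_comm, zpow_mul,
            ← hord, zpow_natCast, pow_orderOf_eq_one, one_zpow, Units.val_one]
        · rw [Ne, Units.val_eq_one, ← orderOf_dvd_iff_zpow_eq_one, hord, ← dvd_neg]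
          rwa [show -(-(q * b) - j) = j + q * b by ring]
    | zero => simp
    | add y z _ _ hy hz => rw [map_add, add_tmul]; exact add_mem hy hz
    | smul c y _ hy => rw [map_smul, ← smul_tmul']; exact S.smul_mem hy c
  have := S.smul_mem (hmem x) (m : k)⁻¹
  rwa [hπ j x hx, sub_self, zpow_zero, Units.val_one, Finset.sum_congr rfl fun l _ => one_pow l,
    Finset.sum_const, Finset.card_range, nsmul_one, ← smul_tmul', smul_smul,
    inv_mul_cancel₀ (Nat.cast_ne_zero.2 hm), one_smul] at this

end IsCyclicPair

end LoopAlgebra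

section LoopIso

open TensorProduct LaurentPolynomial

variable {k M : Type*} [Field k] [Ring M] [Algebra k M]
  {θ : kˣ} {p d : Mˣ} {τ : M →ₗ[k] k} {g n : ℕ} {q s : ℤ}

namespace IsCyclicPair

theorem pow_mul_eq (h : IsCyclicPair θ (g * n) p d τ) :
    ((d ^ n : Mˣ) : M) * (p : M) = ((θ ^ n : kˣ) : k) • ((p : M) * ((d ^ n : Mˣ) : M)) := by
  have := h.zpow_mul_zpow 1 n
  simpa only [zpow_one, one_mul, zpow_natCast] using this

theorem pow_pow_eq_one (h : IsCyclicPair θ (g * n) p d τ) : (d ^ n) ^ g = 1 := by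
  rw [← pow_mul, mul_comm, h.pow_eq_one]

/-- The idempotent `g⁻¹ ∑_{c<g} d^{nc}`. -/
def _root_.cyclicIdem (k : Type*) {M : Type*} [Field k] [Ring M] [Algebra k M] (g n : ℕ)
    (d : Mˣ) : M :=
  powAverage k g ((d ^ n : Mˣ) : M)

theorem idem_mul_idem [CharZero k] (hg : g ≠ 0) (h : IsCyclicPair θ (g * n) p d τ) :
    cyclicIdem k g n d * cyclicIdem k g n d = cyclicIdem k g n d :=
  powAverage_isIdempotentElem hg
    (by rw [← Units.val_pow_eq_pow_val, h.pow_pow_eq_one, Units.val_one])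

theorem _root_.commute_cyclicIdem_zpow (b : ℤ) :
    Commute (cyclicIdem k g n d) ((d ^ b : Mˣ) : M) :=
  Commute.powAverage_left <| Units.ext_iff.1 <| ((Commute.refl d).pow_left n).zpow_right b

theorem commute_idem_zpow (hord : orderOf θ = g * n) (h : IsCyclicPair θ (g * n) p d τ) (a : ℤ) :
    Commute (cyclicIdem k g n d) ((p ^ ((g : ℤ) * a) : Mˣ) : M) := by
  refine Commute.powAverage_left ?_
  have := h.zpow_mul_zpow (g * a) n
  rw [(orderOf_dvd_iff_zpow_eq_one (x := θ)).1, Units.val_one, one_smul, zpow_natCast] at this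
  · exact this
  · rw [hord]
    exact ⟨a, by push_cast; ring⟩

theorem mul_zpow_mul_idem (h : IsCyclicPair θ (g * n) p d τ) (c : ℤ) :
    ((d ^ ((n : ℤ) * c) : Mˣ) : M) * cyclicIdem k g n d = cyclicIdem k g n d := by
  have hx : ((d ^ n : Mˣ) : M) ^ g = 1 := by
    rw [← Units.val_pow_eq_pow_val, h.pow_pow_eq_one, Units.val_one]
  have h1 : ((d ^ n : Mˣ) : M) * cyclicIdem k g n d = cyclicIdem k g n d :=
    self_mul_powAverage hx
  rw [zpow_mul, zpow_natCast]
  induction c with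
  | zero => simp
  | succ c ih => rw [zpow_add_one, Units.val_mul, mul_assoc, h1, ih]
  | pred c ih =>
    rw [← h1, ← mul_assoc, ← Units.val_mul, zpow_sub_one, inv_mul_cancel_right, ih, h1]

/-- The left halves `p^i e ⊗ 1` of the matrix units. -/
def _root_.loopLeft (k : Type*) {M : Type*} [Field k] [Ring M] [Algebra k M] (g n : ℕ)
    (p d : Mˣ) (i : Fin g) : M ⊗[k] k[T;T⁻¹] :=
  (((p ^ (i : ℤ) : Mˣ) : M) * cyclicIdem k g n d) ⊗ₜ[k] T 0

/-- The right halves `e p^{-i} ⊗ 1` of the matrix units. -/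
def _root_.loopRight (k : Type*) {M : Type*} [Field k] [Ring M] [Algebra k M] (g n : ℕ)
    (p d : Mˣ) (i : Fin g) : M ⊗[k] k[T;T⁻¹] :=
  (cyclicIdem k g n d * ((p ^ (-(i : ℤ)) : Mˣ) : M)) ⊗ₜ[k] T 0

theorem loopRight_mul_loopLeft [CharZero k] (hg : g ≠ 0) (hord : orderOf θ = g * n)
    (hn : n ≠ 0) (h : IsCyclicPair θ (g * n) p d τ) (i j : Fin g) :
    loopRight k g n p d i * loopLeft k g n p d j =
      if i = j then cyclicIdem k g n d ⊗ₜ[k] (T 0 : k[T;T⁻¹]) else 0 := by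
  have key : cyclicIdem k g n d * ((p ^ (-(i : ℤ)) : Mˣ) : M) *
      (((p ^ (j : ℤ) : Mˣ) : M) * cyclicIdem k g n d) =
      cyclicIdem k g n d * ((p ^ ((j : ℤ) - i) : Mˣ) : M) * cyclicIdem k g n d := by
    rw [← mul_assoc, mul_assoc (cyclicIdem k g n d), ← Units.val_mul, ← zpow_add, neg_add_eq_sub]
  rw [loopRight, loopLeft, Algebra.TensorProduct.tmul_mul_tmul, ← T_add, add_zero, key]
  split_ifs with hij
  · subst hij
    rw [sub_self, zpow_zero, Units.val_one, mul_one, h.idem_mul_idem hg]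
  · rw [cyclicIdem, powAverage_mul_zpow_mul_powAverage h.pow_pow_eq_one h.pow_mul_eq, zero_tmul]
    rw [Ne, ← orderOf_dvd_iff_zpow_eq_one, orderOf_pow_of_dvd hn
      (by rw [hord]; exact ⟨g, mul_comm _ _⟩), hord, Nat.mul_div_cancel _ (Nat.pos_of_ne_zero hn)]
    intro hd
    apply hij
    have hi := i.isLt
    have hj := j.isLt
    have := Int.eq_zero_of_abs_lt_dvd hd (by rw [abs_lt]; constructor <;> omega)
    exact Fin.ext (by omega)

theorem sum_loopLeft_mul_loopRight [CharZero k] (hg : g ≠ 0) (hord : orderOf θ = g * n)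
    (hn : n ≠ 0) (h : IsCyclicPair θ (g * n) p d τ) :
    ∑ i, loopLeft k g n p d i * loopRight k g n p d i = 1 := by
  have hω : orderOf (θ ^ n) = g := by
    rw [orderOf_pow_of_dvd hn (by rw [hord]; exact ⟨g, mul_comm _ _⟩), hord,
      Nat.mul_div_cancel _ (Nat.pos_of_ne_zero hn)]
  have key := sum_conj_powAverage hg h.pow_mul_eq hω
  rw [← Fin.sum_univ_eq_sum_range (fun i => (((p ^ (i : ℤ) : Mˣ) : M) *
    powAverage k g ((d ^ n : Mˣ) : M) * ((p ^ (-(i : ℤ)) : Mˣ) : M)))] at key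
  have hi : ∀ i : Fin g, loopLeft k g n p d i * loopRight k g n p d i =
      (((p ^ (i : ℤ) : Mˣ) : M) * cyclicIdem k g n d * ((p ^ (-(i : ℤ)) : Mˣ) : M)) ⊗ₜ[k] T 0 := by
    intro i
    rw [loopLeft, loopRight, Algebra.TensorProduct.tmul_mul_tmul, ← T_add, add_zero, mul_assoc,
      ← mul_assoc (cyclicIdem k g n d) (cyclicIdem k g n d), h.idem_mul_idem hg, ← mul_assoc]
  simp only [hi, ← sum_tmul]
  rw [T_zero, Algebra.TensorProduct.one_def]
  exact congrArg (· ⊗ₜ[k] 1) key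

/-- The unit `x ⊗ z^j`. -/
def _root_.tmulUnit (k : Type*) {M : Type*} [Field k] [Ring M] [Algebra k M] (x : Mˣ) (j : ℤ) :
    (M ⊗[k] k[T;T⁻¹])ˣ where
  val := (x : M) ⊗ₜ[k] T j
  inv := (↑x⁻¹ : M) ⊗ₜ[k] T (-j)
  val_inv := by
    rw [Algebra.TensorProduct.tmul_mul_tmul, ← T_add, add_neg_cancel, Units.mul_inv, T_zero,
      Algebra.TensorProduct.one_def]
  inv_val := by
    rw [Algebra.TensorProduct.tmul_mul_tmul, ← T_add, neg_add_cancel, Units.inv_mul, T_zero,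
      Algebra.TensorProduct.one_def]

theorem _root_.tmulUnit_zpow (x : Mˣ) (j a : ℤ) :
    tmulUnit k x j ^ a = tmulUnit k (x ^ a) (a * j) := by
  have h1 : ∀ (x y : Mˣ) (i j : ℤ),
      tmulUnit k x i * tmulUnit k y j = tmulUnit k (x * y) (i + j) := fun x y i j =>
    Units.ext (by
      simp only [tmulUnit, Units.val_mul, Algebra.TensorProduct.tmul_mul_tmul, T_add])
  induction a with
  | zero =>
    refine Units.ext ?_
    simp [tmulUnit, Algebra.TensorProduct.one_def]
  | succ a ih => rw [zpow_add_one, ih, h1, zpow_add_one, add_mul, one_mul]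
  | pred a ih =>
    rw [zpow_sub_one, ih, mul_inv_eq_iff_eq_mul, h1, zpow_sub_one, inv_mul_cancel_right, sub_mul,
      one_mul, sub_add_cancel]

theorem tmulUnit_mul_eq (h : IsCyclicPair θ (g * n) p d τ) (s : ℤ) :
    (tmulUnit k (p ^ (g : ℤ)) 0 * tmulUnit k (d ^ (-s)) g : M ⊗[k] k[T;T⁻¹]) =
      ((θ ^ ((g : ℤ) * s) : kˣ) : k) •
        (tmulUnit k (d ^ (-s)) g * tmulUnit k (p ^ (g : ℤ)) 0 : M ⊗[k] k[T;T⁻¹]) := by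
  simp only [tmulUnit, Algebra.TensorProduct.tmul_mul_tmul, ← T_add, h.zpow_mul_zpow, smul_tmul',
    smul_smul, ← Units.val_mul, ← zpow_add]
  simp

/-- The embedding of the quantum torus in the loop algebra. -/
def loopQ (h : IsCyclicPair θ (g * n) p d τ) (s : ℤ) :
    QT k ((θ ^ ((g : ℤ) * s) : kˣ) : k) →ₐ[k] M ⊗[k] k[T;T⁻¹] :=
  qLift _ _ (h.tmulUnit_mul_eq s)

theorem loopQ_apply (h : IsCyclicPair θ (g * n) p d τ) (s a b : ℤ) :
    h.loopQ s (↑(qUnitOne k ((θ ^ ((g : ℤ) * s) : kˣ) : k) ^ a) *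
        ↑(qUnitTwo k ((θ ^ ((g : ℤ) * s) : kˣ) : k) ^ b)) =
      (↑(p ^ ((g : ℤ) * a)) * ↑(d ^ (-s * b)) : M) ⊗ₜ[k] T (g * b) := by
  rw [loopQ, qLift_zpow_mul_zpow, tmulUnit_zpow, tmulUnit_zpow]
  simp only [tmulUnit, Algebra.TensorProduct.tmul_mul_tmul, ← T_add, ← zpow_mul]
  rw [mul_zero, zero_add, mul_comm b]

theorem commute_idem_loopQ (hord : orderOf θ = g * n) (h : IsCyclicPair θ (g * n) p d τ) (s : ℤ)
    (b : QT k ((θ ^ ((g : ℤ) * s) : kˣ) : k)) :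
    Commute (cyclicIdem k g n d ⊗ₜ[k] (T 0 : k[T;T⁻¹])) (h.loopQ s b) := by
  induction mem_span_qUnit _ b using Submodule.span_induction with
  | mem b hb =>
    obtain ⟨⟨a, b⟩, rfl⟩ := hb
    dsimp only
    rw [loopQ_apply, commute_iff_eq, Algebra.TensorProduct.tmul_mul_tmul,
      Algebra.TensorProduct.tmul_mul_tmul, ← T_add, ← T_add, add_comm,
      ((h.commute_idem_zpow hord a).mul_right (commute_cyclicIdem_zpow _)).eq]
  | zero => rw [map_zero]; exact Commute.zero_right _
  | add x y _ _ hx hy => rw [map_add]; exact hx.add_right hy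
  | smul c x _ hx => rw [map_smul]; exact hx.smul_right c

theorem loopQ_mul_idem_injective [CharZero k] (hg : g ≠ 0)
    (h : IsCyclicPair θ (g * n) p d τ) (s : ℤ) (b : QT k ((θ ^ ((g : ℤ) * s) : kˣ) : k))
    (hb : h.loopQ s b * cyclicIdem k g n d ⊗ₜ[k] (T 0 : k[T;T⁻¹]) = 0) : b = 0 := by
  have hτ : ∀ y, τ (y * cyclicIdem k g n d) = τ y := map_mul_powAverage hg τ fun y => by
    rw [← zpow_natCast, h.map_mul_zpow]
  let w : ℤ × ℤ → M ⊗[k] k[T;T⁻¹] := fun ab =>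
    (↑(p ^ ((g : ℤ) * ab.1)) * ↑(d ^ (-s * ab.2)) * cyclicIdem k g n d : M) ⊗ₜ[k] T (g * ab.2)
  let f : ℤ × ℤ → Module.Dual k (M ⊗[k] k[T;T⁻¹]) := fun ab =>
    LinearMap.mul' k k ∘ₗ TensorProduct.map
      (τ ∘ₗ LinearMap.mulLeft k ((p ^ (-((g : ℤ) * ab.1)) : Mˣ) : M)) (laurentCoeff k (g * ab.2))
  have hfw : ∀ ab ab', f ab (w ab') = if ab = ab' then 1 else 0 := by
    rintro ⟨a, b⟩ ⟨a', b'⟩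
    have hg' : (g : ℤ) ≠ 0 := by exact_mod_cast hg
    simp only [f, w, LinearMap.comp_apply, TensorProduct.map_tmul, LinearMap.mulLeft_apply,
      LinearMap.mul'_apply, laurentCoeff_T]
    rw [← mul_assoc, hτ, ← mul_assoc, h.map_mul_zpow, ← Units.val_mul, ← zpow_add, h.map_zpow]
    have h1 : -((g : ℤ) * a) + g * a' = 0 ↔ a = a' := by
      rw [neg_add_eq_zero, mul_right_inj' hg']
    have h2 : (g : ℤ) * b' = g * b ↔ b = b' := by rw [mul_right_inj' hg', eq_comm]
    simp only [h1, h2, Prod.mk.injEq, ite_and]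
    split_ifs <;> simp
  have hw : LinearIndependent k w :=
    LinearIndependent.of_pairwise_dual_eq_zero_one w f
      (fun i j hij => (hfw i j).trans (if_neg hij)) fun i =>
      (hfw i i).trans (if_pos rfl)
  obtain ⟨c, rfl⟩ := Finsupp.mem_span_range_iff_exists_finsupp.1 (mem_span_qUnit _ b)
  have hc : Finsupp.linearCombination k w c = 0 := by
    rw [← hb, Finsupp.linearCombination_apply, Finsupp.sum, Finsupp.sum, map_sum, Finset.sum_mul]
    refine Finset.sum_congr rfl fun ab _ => ?_
    rw [map_smul, loopQ_apply, smul_mul_assoc, Algebra.TensorProduct.tmul_mul_tmul, ← T_add,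
      add_zero]
  rw [linearIndependent_iff.1 hw c hc, Finsupp.sum_zero_index]

theorem loopLeft_mul_idem [CharZero k] (hg : g ≠ 0) (h : IsCyclicPair θ (g * n) p d τ)
    (i : Fin g) : loopLeft k g n p d i * cyclicIdem k g n d ⊗ₜ[k] (T 0 : k[T;T⁻¹]) =
      loopLeft k g n p d i := by
  rw [loopLeft, Algebra.TensorProduct.tmul_mul_tmul, ← T_add, add_zero, mul_assoc,
    h.idem_mul_idem hg]

/-- The homomorphism from matrices over the quantum torus whose range is the loop algebra. -/
def loopHom [CharZero k] (hg : g ≠ 0) (hn : n ≠ 0) (hord : orderOf θ = g * n)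
    (h : IsCyclicPair θ (g * n) p d τ) (s : ℤ) :
    Matrix (Fin g) (Fin g) (QT k ((θ ^ ((g : ℤ) * s) : kˣ) : k)) →ₐ[k] M ⊗[k] k[T;T⁻¹] :=
  matrixUnitLift (h.loopQ s) (loopLeft k g n p d) (loopRight k g n p d)
    (cyclicIdem k g n d ⊗ₜ[k] (T 0 : k[T;T⁻¹]))
    (h.loopRight_mul_loopLeft hg hord hn) (h.sum_loopLeft_mul_loopRight hg hord hn)
    (h.loopLeft_mul_idem hg) (h.commute_idem_loopQ hord s)

theorem loopHom_injective [CharZero k] (hg : g ≠ 0) (hn : n ≠ 0) (hord : orderOf θ = g * n)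
    (h : IsCyclicPair θ (g * n) p d τ) (s : ℤ) :
    Function.Injective (h.loopHom hg hn hord s) :=
  matrixUnitLift_injective (h.loopQ_mul_idem_injective hg s)

theorem idem_tmul_mem_loopAssoc (hord : orderOf θ = g * n)
    (h : IsCyclicPair θ (g * n) p d τ) (q : ℤ) :
    cyclicIdem k g n d ⊗ₜ[k] (T 0 : k[T;T⁻¹]) ∈ loopAssoc k M (Ad p ^ ((g : ℤ) * q)) θ := by
  rw [cyclicIdem, powAverage, ← smul_tmul', sum_tmul]
  refine Subalgebra.smul_mem _ (sum_mem fun c _ => ?_) _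
  have := h.tmul_mem_loopAssoc (k := k) hord (q := g * q) (a := 0) (b := n * c) (j := 0)
    ⟨q * c, by push_cast; ring⟩
  rwa [zpow_zero, Units.val_one, one_mul, zpow_mul d, zpow_natCast d,
    zpow_natCast (d ^ n), Units.val_pow_eq_pow_val] at this

theorem zpow_tmul_mem_loopAssoc (hord : orderOf θ = g * n)
    (h : IsCyclicPair θ (g * n) p d τ) (q a : ℤ) :
    ((p ^ a : Mˣ) : M) ⊗ₜ[k] (T 0 : k[T;T⁻¹]) ∈ loopAssoc k M (Ad p ^ q) θ := by
  simpa using h.tmul_mem_loopAssoc (k := k) hord (q := q) (a := a) (b := 0) (j := 0) (by simp)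

theorem range_loopHom_le [CharZero k] (hg : g ≠ 0) (hn : n ≠ 0) (hord : orderOf θ = g * n)
    (h : IsCyclicPair θ (g * n) p d τ) (hs : s * q ≡ 1 [ZMOD n]) :
    (h.loopHom hg hn hord s).range ≤ loopAssoc k M (Ad p ^ ((g : ℤ) * q)) θ := by
  rintro _ ⟨N, rfl⟩
  change h.loopHom hg hn hord s N ∈ _
  rw [loopHom, matrixUnitLift_apply]
  refine sum_mem fun i _ => sum_mem fun j _ => mul_mem (mul_mem ?_ ?_) ?_
  · have := mul_mem (h.zpow_tmul_mem_loopAssoc hord (g * q) i) (h.idem_tmul_mem_loopAssoc hord q)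
    rwa [Algebra.TensorProduct.tmul_mul_tmul, ← T_add] at this
  · generalize N i j = z
    induction mem_span_qUnit _ z using Submodule.span_induction with
    | mem b hb =>
      obtain ⟨⟨a, b⟩, rfl⟩ := hb
      dsimp only
      rw [loopQ_apply]
      apply h.tmul_mem_loopAssoc hord
      obtain ⟨c, hc⟩ := hs.dvd
      exact ⟨c * b, by push_cast; linear_combination (g : ℤ) * b * hc⟩
    | zero => rw [map_zero]; exact zero_mem _
    | add x y _ _ hx hy => rw [map_add]; exact add_mem hx hy
    | smul c x _ hx => rw [map_smul]; exact Subalgebra.smul_mem _ hx c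
  · have := mul_mem (h.idem_tmul_mem_loopAssoc hord q)
      (h.zpow_tmul_mem_loopAssoc hord (g * q) (-(j : ℤ)))
    rwa [Algebra.TensorProduct.tmul_mul_tmul, ← T_add] at this

theorem zpow_mul_idem_tmul_mem_range [CharZero k] (hg : g ≠ 0) (hn : n ≠ 0)
    (hord : orderOf θ = g * n) (h : IsCyclicPair θ (g * n) p d τ) (s a b : ℤ) (i : Fin g) :
    (↑(p ^ a) * ↑(d ^ (-s * b)) * cyclicIdem k g n d * ↑(p ^ (-(i : ℤ))) : M) ⊗ₜ[k]
      (T (g * b) : k[T;T⁻¹]) ∈ (h.loopHom hg hn hord s).range := by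
  have hg' : (0 : ℤ) < g := by exact_mod_cast Nat.pos_of_ne_zero hg
  have h0 := Int.emod_nonneg a hg'.ne'
  have h1 := Int.emod_lt_of_pos a hg'
  let i' : Fin g := ⟨(a % g).toNat, by omega⟩
  have hi' : ((i' : ℕ) : ℤ) = a % g := Int.toNat_of_nonneg h0
  refine ⟨Matrix.single i' i (↑(qUnitOne k ((θ ^ ((g : ℤ) * s) : kˣ) : k) ^ (a / g)) *
    ↑(qUnitTwo k ((θ ^ ((g : ℤ) * s) : kˣ) : k) ^ b)), ?_⟩
  change h.loopHom hg hn hord s _ = _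
  rw [loopHom, matrixUnitLift_single, loopQ_apply, loopLeft, loopRight,
    Algebra.TensorProduct.tmul_mul_tmul, Algebra.TensorProduct.tmul_mul_tmul, ← T_add, ← T_add,
    add_zero, zero_add, hi']
  congr 1
  rw [mul_assoc _ (cyclicIdem k g n d),
    ((h.commute_idem_zpow hord (a / g)).mul_right (commute_cyclicIdem_zpow _)).eq,
    ← mul_assoc, mul_assoc _ (_ * cyclicIdem k g n d) (cyclicIdem k g n d),
    mul_assoc _ (cyclicIdem k g n d) (cyclicIdem k g n d), h.idem_mul_idem hg, ← mul_assoc,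
    ← mul_assoc, ← Units.val_mul (p ^ _), ← zpow_add, Int.emod_add_mul_ediv]

theorem tmul_mem_range [CharZero k] (hg : g ≠ 0) (hn : n ≠ 0)
    (hord : orderOf θ = g * n) (h : IsCyclicPair θ (g * n) p d τ) (hs : s * q ≡ 1 [ZMOD n])
    {a b j : ℤ} (hj : ((g * n : ℕ) : ℤ) ∣ j + g * q * b) :
    (↑(p ^ a) * ↑(d ^ b) : M) ⊗ₜ[k] (T j : k[T;T⁻¹]) ∈ (h.loopHom hg hn hord s).range := by
  obtain ⟨c, hc⟩ := hj
  obtain ⟨c', hc'⟩ := hs.dvd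
  have hjg : j = g * (n * c - q * b) := by
    push_cast at hc
    linear_combination hc
  set l := n * c - q * b with hl
  have hb : b = -s * l + n * (s * c + c' * b) := by
    rw [hl]
    linear_combination b * hc'
  have hsum := congrArg (((↑(p ^ a) * ↑(d ^ b) : M) ⊗ₜ[k] (T j : k[T;T⁻¹])) * ·)
    (h.sum_loopLeft_mul_loopRight hg hord hn)
  simp only [mul_one, Finset.mul_sum] at hsum
  rw [← hsum]
  refine sum_mem fun i _ => ?_
  have key : (↑(p ^ a) * ↑(d ^ b) : M) * (↑(p ^ (i : ℤ)) * cyclicIdem k g n d *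
      (cyclicIdem k g n d * ↑(p ^ (-(i : ℤ))))) =
      ((θ ^ ((i : ℤ) * b) : kˣ) : k) •
        (↑(p ^ (a + i)) * ↑(d ^ (-s * l)) * cyclicIdem k g n d * ↑(p ^ (-(i : ℤ))) : M) := by
    calc _ = (↑(p ^ a) : M) * (↑(d ^ b) * ↑(p ^ (i : ℤ))) *
          (cyclicIdem k g n d * cyclicIdem k g n d) * ↑(p ^ (-(i : ℤ))) := by
          simp only [mul_assoc]
      _ = ((θ ^ ((i : ℤ) * b) : kˣ) : k) • ((↑(p ^ a) : M) * (↑(p ^ (i : ℤ)) *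
          (↑(d ^ b) * cyclicIdem k g n d)) * ↑(p ^ (-(i : ℤ)))) := by
          rw [h.zpow_mul_zpow, h.idem_mul_idem hg]
          simp only [mul_assoc, mul_smul_comm, smul_mul_assoc]
      _ = _ := by
          have hbe : (↑(d ^ b) * cyclicIdem k g n d : M) =
              ↑(d ^ (-s * l)) * cyclicIdem k g n d := by
            conv_lhs => rw [hb]
            rw [zpow_add, Units.val_mul, mul_assoc, h.mul_zpow_mul_idem]
          rw [hbe, zpow_add, Units.val_mul]
          simp only [mul_assoc]
  rw [loopLeft, loopRight, Algebra.TensorProduct.tmul_mul_tmul,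
    Algebra.TensorProduct.tmul_mul_tmul, ← T_add, ← T_add, add_zero, add_zero, key, ← smul_tmul',
    hjg]
  exact Subalgebra.smul_mem _ (h.zpow_mul_idem_tmul_mem_range hg hn hord s _ _ _) _

theorem nonempty_loopAssoc_algEquiv [CharZero k] (hg : g ≠ 0) (hn : n ≠ 0)
    (hord : orderOf θ = g * n) (h : IsCyclicPair θ (g * n) p d τ) (hs : s * q ≡ 1 [ZMOD n]) :
    Nonempty (loopAssoc k M (Ad p ^ ((g : ℤ) * q)) θ ≃ₐ[k]
      Matrix (Fin g) (Fin g) (QT k ((θ ^ ((g : ℤ) * s) : kˣ) : k))) := by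
  have hrange : (h.loopHom hg hn hord s).range = loopAssoc k M (Ad p ^ ((g : ℤ) * q)) θ :=
    le_antisymm (h.range_loopHom_le hg hn hord hs)
      (h.loopAssoc_le hord (mul_ne_zero hg hn) _ fun _ _ _ hj =>
        h.tmul_mem_range hg hn hord hs hj)
  exact ⟨((AlgEquiv.ofInjective _ (h.loopHom_injective hg hn hord s)).trans
    (Subalgebra.equivOfEq _ _ hrange)).symm⟩

end IsCyclicPair

end LoopIso

section ShiftMatrix

open LaurentPolynomial

theorem pUnit_mul_apply {R : Type*} [CommRing R] (m : ℕ) [NeZero m] (u : Rˣ)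
    (x : Matrix (Fin m) (Fin m) R) (i j : Fin m) :
    ((pUnit m u : Matrix (Fin m) (Fin m) R) * x) (i + 1) j =
      (if (i : ℕ) = m - 1 then (u : R) else 1) * x i j := by
  rw [Matrix.mul_apply, Finset.sum_eq_single i]
  · simp [pUnit]
  · intro l _ hl
    simp [pUnit, hl.symm]
  · simp

theorem Fin.val_add_one_eq_ite {m : ℕ} [NeZero m] (i : Fin m) :
    ((i + 1 : Fin m) : ℕ) = if (i : ℕ) = m - 1 then 0 else (i : ℕ) + 1 := by
  have hm := NeZero.pos m
  have hi := i.isLt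
  rw [Fin.val_add, Fin.val_one', Nat.add_mod_mod]
  split_ifs with h
  · rw [h, Nat.sub_add_cancel hm, Nat.mod_self]
  · exact Nat.mod_eq_of_lt (by omega)

theorem pUnit_pow_apply_zero {R : Type*} [CommRing R] (m : ℕ) [NeZero m] (u : Rˣ) (n : ℕ)
    (hn : n < m) (i : Fin m) :
    ((pUnit m u : Matrix (Fin m) (Fin m) R) ^ n) i 0 = if (i : ℕ) = n then 1 else 0 := by
  induction n generalizing i with
  | zero =>
    rw [pow_zero, Matrix.one_apply]
    simp only [Fin.val_eq_zero_iff]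
  | succ n ih =>
    obtain ⟨i, rfl⟩ : ∃ i', i = i' + 1 := ⟨i - 1, (sub_add_cancel i 1).symm⟩
    rw [pow_succ', pUnit_mul_apply, ih (by omega), Fin.val_add_one_eq_ite]
    split_ifs <;> first | contradiction | omega | simp

theorem pUnit_pow_apply_self {R : Type*} [CommRing R] (m : ℕ) [NeZero m] (u : Rˣ) (n : ℕ)
    (i j : Fin m) (hn : (i : ℕ) = n) :
    ((pUnit m u : Matrix (Fin m) (Fin m) R) ^ n) i j = if j = 0 then 1 else 0 := by
  induction n generalizing i with
  | zero =>
    obtain rfl : i = 0 := Fin.val_eq_zero_iff.1 hn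
    rw [pow_zero, Matrix.one_apply]
    simp only [eq_comm]
  | succ n ih =>
    obtain ⟨i, rfl⟩ : ∃ i', i = i' + 1 := ⟨i - 1, (sub_add_cancel i 1).symm⟩
    rw [Fin.val_add_one_eq_ite] at hn
    split_ifs at hn with h
    rw [pow_succ', pUnit_mul_apply, if_neg h, one_mul, ih _ (by omega)]

theorem pUnit_pow {R : Type*} [CommRing R] (m : ℕ) [NeZero m] (u : Rˣ) :
    pUnit m u ^ m = Units.map (Matrix.scalar (Fin m) : R →+* Matrix (Fin m) (Fin m) R) u := by
  have h0 : ∀ i : Fin m, ((pUnit m u : Matrix (Fin m) (Fin m) R) ^ m) i 0 =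
      if i = 0 then (u : R) else 0 := by
    intro i
    have hm := NeZero.pos m
    obtain ⟨i, rfl⟩ : ∃ i', i = i' + 1 := ⟨i - 1, (sub_add_cancel i 1).symm⟩
    obtain ⟨m', hm'⟩ : ∃ m', m = m' + 1 := ⟨m - 1, by omega⟩
    conv_lhs => enter [2]; rw [hm']
    rw [pow_succ', pUnit_mul_apply, pUnit_pow_apply_zero _ _ _ (by omega)]
    simp only [← Fin.val_eq_zero_iff, Fin.val_add_one_eq_ite]
    split_ifs <;> first | contradiction | omega | simp
  refine Units.ext ?_
  ext i j
  have h1 : ((pUnit m u : Matrix (Fin m) (Fin m) R) ^ m) i j =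
      ((pUnit m u : Matrix (Fin m) (Fin m) R) ^ m * (pUnit m u) ^ (j : ℕ)) i 0 := by
    rw [Matrix.mul_apply, Finset.sum_eq_single j]
    · rw [pUnit_pow_apply_zero _ _ _ j.isLt, if_pos rfl, mul_one]
    · intro l _ hl
      rw [pUnit_pow_apply_zero _ _ _ j.isLt, if_neg fun h => hl (Fin.ext h), mul_zero]
    · simp
  rw [Units.val_pow_eq_pow_val, h1, ← pow_add, add_comm, pow_add, Matrix.mul_apply,
    Finset.sum_eq_single 0]
  · rw [h0, if_pos rfl, pUnit_pow_apply_zero _ _ _ j.isLt]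
    simp [Matrix.diagonal_apply, Fin.ext_iff]
  · intro l _ hl
    rw [h0, if_neg hl, mul_zero]
  · simp

variable {k : Type*} [Field k] (m : ℕ) {θ : kˣ}

/-- The diagonal matrix `diag(1, θ, …, θ^{m-1})` over the Laurent polynomials. -/
def clockUnit (θ : kˣ) : (Matrix (Fin m) (Fin m) k[T;T⁻¹])ˣ :=
  dUnit m (Units.map (algebraMap k k[T;T⁻¹] : k →* k[T;T⁻¹]) θ)

theorem clockUnit_val (θ : kˣ) : (clockUnit m θ : Matrix (Fin m) (Fin m) k[T;T⁻¹]) =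
    Matrix.diagonal fun i : Fin m => algebraMap k k[T;T⁻¹] ((θ : k) ^ (i : ℕ)) := by
  simp [clockUnit, dUnit]

theorem clockUnit_pow (hord : orderOf θ = m) : clockUnit m θ ^ m = 1 := by
  have hθm : θ ^ m = 1 := by rw [← hord, pow_orderOf_eq_one]
  refine Units.ext ?_
  rw [Units.val_pow_eq_pow_val, clockUnit_val, Matrix.diagonal_pow, Units.val_one,
    ← Matrix.diagonal_one]
  congr 1
  ext1 i
  rw [Pi.pow_apply, ← map_pow, ← pow_mul, mul_comm, pow_mul, ← Units.val_pow_eq_pow_val θ m,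
    hθm, Units.val_one, one_pow, map_one]

variable [NeZero m]

theorem pUnit_tUnit_zpow (n : ℤ) :
    ((pUnit m (tUnit k) ^ ((m : ℤ) * n) : (Matrix (Fin m) (Fin m) k[T;T⁻¹])ˣ) :
      Matrix (Fin m) (Fin m) k[T;T⁻¹]) = Matrix.scalar (Fin m) (T n) := by
  rw [zpow_mul, zpow_natCast, pUnit_pow, ← map_zpow, Units.coe_map, tUnit_zpow]
  rfl

theorem clockUnit_mul_pUnit (hord : orderOf θ = m) :
    (clockUnit m θ * pUnit m (tUnit k) : Matrix (Fin m) (Fin m) k[T;T⁻¹]) =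
      (θ : k) • (pUnit m (tUnit k) * clockUnit m θ : Matrix (Fin m) (Fin m) k[T;T⁻¹]) := by
  ext1 i j
  rw [clockUnit_val, Matrix.diagonal_mul, Matrix.smul_apply, Matrix.mul_diagonal]
  by_cases hij : i = j + 1
  · subst hij
    have hθ : (θ : k) ^ ((j + 1 : Fin m) : ℕ) = θ * (θ : k) ^ (j : ℕ) := by
      have hmod := pow_mod_orderOf θ ((j : ℕ) + 1)
      rw [hord] at hmod
      rw [Fin.val_add, Fin.val_one', Nat.add_mod_mod, ← Units.val_pow_eq_pow_val, hmod,
        pow_succ', Units.val_mul, Units.val_pow_eq_pow_val]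
    rw [hθ, map_mul, Algebra.smul_def]
    ring
  · simp [pUnit, hij]

theorem powAverage_clockUnit [CharZero k] (hord : orderOf θ = m) :
    powAverage k m (clockUnit m θ : Matrix (Fin m) (Fin m) k[T;T⁻¹]) = Matrix.single 0 0 1 := by
  have hm : (m : k) ≠ 0 := Nat.cast_ne_zero.2 (NeZero.ne m)
  have hθm : θ ^ m = 1 := by rw [← hord, pow_orderOf_eq_one]
  have hsum : ∀ i : Fin m, ∑ c ∈ Finset.range m, ((θ : k) ^ (i : ℕ)) ^ c =
      if i = 0 then (m : k) else 0 := by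
    intro i
    split_ifs with hi
    · simp [hi]
    · apply geom_sum_eq_zero_of_pow_eq_one
      · rw [← pow_mul, mul_comm, pow_mul, ← Units.val_pow_eq_pow_val θ m, hθm,
          Units.val_one, one_pow]
      · rw [← Units.val_pow_eq_pow_val, Ne, Units.val_eq_one, ← orderOf_dvd_iff_pow_eq_one, hord]
        exact fun h => hi (Fin.val_eq_zero_iff.1 (Nat.eq_zero_of_dvd_of_lt h i.isLt))
  ext1 i j
  rw [powAverage, Matrix.smul_apply, Matrix.sum_apply, clockUnit_val]
  simp only [Matrix.diagonal_pow]
  by_cases hij : i = j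
  · subst hij
    simp only [Matrix.diagonal_apply_eq, Pi.pow_apply, ← map_pow]
    rw [← map_sum, hsum]
    by_cases hi : i = 0
    · subst hi
      rw [if_pos rfl, Matrix.single_apply_same, Algebra.smul_def, ← map_mul, inv_mul_cancel₀ hm,
        map_one]
    · simp [hi, Ne.symm hi]
  · have : ¬ (0 = i ∧ 0 = j) := fun h => hij (h.1.symm.trans h.2)
    simp [Matrix.diagonal_apply_ne _ hij, this]

theorem adjoin_pUnit_clockUnit [CharZero k] (hord : orderOf θ = m) :
    Algebra.adjoin k ({(pUnit m (tUnit k) : Matrix (Fin m) (Fin m) k[T;T⁻¹]),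
      ↑(pUnit m (tUnit k))⁻¹, (clockUnit m θ : Matrix (Fin m) (Fin m) k[T;T⁻¹]),
      ↑(clockUnit m θ)⁻¹} : Set (Matrix (Fin m) (Fin m) k[T;T⁻¹])) = ⊤ := by
  set S := Algebra.adjoin k ({(pUnit m (tUnit k) : Matrix (Fin m) (Fin m) k[T;T⁻¹]),
      ↑(pUnit m (tUnit k))⁻¹, (clockUnit m θ : Matrix (Fin m) (Fin m) k[T;T⁻¹]),
      ↑(clockUnit m θ)⁻¹} : Set (Matrix (Fin m) (Fin m) k[T;T⁻¹])) with hS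
  set p := pUnit m (tUnit k)
  have hpS : (p : Matrix (Fin m) (Fin m) k[T;T⁻¹]) ∈ S :=
    Algebra.subset_adjoin (Or.inl rfl)
  have hpS' : ((p⁻¹ : (Matrix (Fin m) (Fin m) k[T;T⁻¹])ˣ) : Matrix (Fin m) (Fin m) k[T;T⁻¹]) ∈ S :=
    Algebra.subset_adjoin (Or.inr (Or.inl rfl))
  have hdS : (clockUnit m θ : Matrix (Fin m) (Fin m) k[T;T⁻¹]) ∈ S :=
    Algebra.subset_adjoin (Or.inr (Or.inr (Or.inl rfl)))
  have hp : ∀ n : ℤ, ((p ^ n : (Matrix (Fin m) (Fin m) k[T;T⁻¹])ˣ) :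
      Matrix (Fin m) (Fin m) k[T;T⁻¹]) ∈ S := by
    intro n
    cases n with
    | ofNat n =>
      rw [Int.ofNat_eq_natCast, zpow_natCast, Units.val_pow_eq_pow_val]
      exact pow_mem hpS n
    | negSucc n =>
      rw [zpow_negSucc, ← inv_pow, Units.val_pow_eq_pow_val]
      exact pow_mem hpS' _
  have he : Matrix.single 0 0 1 ∈ S := by
    rw [← powAverage_clockUnit m hord]
    exact S.smul_mem (sum_mem fun c _ => pow_mem hdS c) _
  have hcol : ∀ i : Fin m, (p : Matrix (Fin m) (Fin m) k[T;T⁻¹]) ^ (i : ℕ) *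
      Matrix.single 0 0 1 = Matrix.single i 0 1 := by
    intro i
    ext1 a b
    by_cases hb : b = 0
    · subst hb
      rw [Matrix.mul_single_apply_same, mul_one, pUnit_pow_apply_zero _ _ _ i.isLt,
        Matrix.single_apply]
      simp [Fin.ext_iff, eq_comm]
    · rw [Matrix.mul_single_apply_of_ne _ _ _ _ _ hb, Matrix.single_apply, if_neg]
      exact fun h => hb h.2.symm
  have hrow : ∀ j : Fin m, Matrix.single 0 j 1 *
      (p : Matrix (Fin m) (Fin m) k[T;T⁻¹]) ^ (j : ℕ) = Matrix.single 0 0 1 := by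
    intro j
    ext1 a b
    by_cases ha : a = 0
    · subst ha
      rw [Matrix.single_mul_apply_same, one_mul, pUnit_pow_apply_self _ _ _ _ _ rfl,
        Matrix.single_apply]
      simp [eq_comm]
    · rw [Matrix.single_mul_apply_of_ne _ _ _ _ _ ha, Matrix.single_apply, if_neg]
      exact fun h => ha h.1.symm
  have hT : ∀ (i j : Fin m) (n : ℤ), Matrix.single i j (T n : k[T;T⁻¹]) ∈ S := by
    intro i j n
    have h1 : Matrix.single 0 j 1 = Matrix.single 0 0 1 *
        (↑(p ^ (-(j : ℤ))) : Matrix (Fin m) (Fin m) k[T;T⁻¹]) := by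
      rw [zpow_neg, zpow_natCast, Units.eq_mul_inv_iff_mul_eq, Units.val_pow_eq_pow_val, hrow]
    have h2 : Matrix.single i j (T n : k[T;T⁻¹]) =
        Matrix.single i 0 1 * Matrix.single 0 j 1 * Matrix.scalar (Fin m) (T n) := by
      rw [Matrix.single_mul_single_same, ← Matrix.scalar_comm _ fun r => Commute.all _ _,
        Matrix.scalar_apply, ← Matrix.smul_eq_diagonal_mul, Matrix.smul_single]
      simp
    rw [h2, h1, ← hcol, ← pUnit_tUnit_zpow]
    exact mul_mem (mul_mem (mul_mem (pow_mem hpS _) he)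
      (mul_mem he (hp _))) (hp _)
  rw [eq_top_iff]
  rintro x -
  rw [Matrix.matrix_eq_sum_single x]
  refine sum_mem fun i _ => sum_mem fun j _ => ?_
  generalize x i j = r
  induction r using LaurentPolynomial.induction_on' with
  | add r r' hr hr' => rw [Matrix.single_add]; exact add_mem hr hr'
  | C_mul_T n a =>
    rw [← smul_eq_C_mul, ← Matrix.smul_single]
    exact S.smul_mem (hT i j n) a

/-- The constant coefficient of the top left entry. -/
def cornerCoeff (k : Type*) [Field k] (m : ℕ) [NeZero m] :
    Matrix (Fin m) (Fin m) k[T;T⁻¹] →ₗ[k] k :=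
  laurentCoeff k 0 ∘ₗ Matrix.entryLinearMap k k[T;T⁻¹] 0 0

theorem cornerCoeff_apply (x : Matrix (Fin m) (Fin m) k[T;T⁻¹]) :
    cornerCoeff k m x = laurentCoeff k 0 (x 0 0) := rfl

theorem mul_clockUnit_apply_zero (x : Matrix (Fin m) (Fin m) k[T;T⁻¹]) :
    (x * clockUnit m θ) 0 0 = x 0 0 := by
  rw [clockUnit_val, Matrix.mul_diagonal]
  simp

theorem clockUnit_mul_apply_zero (x : Matrix (Fin m) (Fin m) k[T;T⁻¹]) :
    (clockUnit m θ * x) 0 0 = x 0 0 := by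
  rw [clockUnit_val, Matrix.diagonal_mul]
  simp

theorem isCyclicPair_pUnit_clockUnit [CharZero k] (hord : orderOf θ = m) :
    IsCyclicPair θ m (pUnit m (tUnit k)) (clockUnit m θ) (cornerCoeff k m) where
  mul_eq := clockUnit_mul_pUnit m hord
  pow_eq_one := clockUnit_pow m hord
  adjoin_eq_top := adjoin_pUnit_clockUnit m hord
  map_mul x := by rw [cornerCoeff_apply, mul_clockUnit_apply_zero, cornerCoeff_apply]
  map_zpow n := by
    rw [cornerCoeff_apply]
    by_cases hd : (m : ℤ) ∣ n
    · obtain ⟨c, rfl⟩ := hd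
      rw [pUnit_tUnit_zpow, Matrix.scalar_apply, Matrix.diagonal_apply_eq, laurentCoeff_T]
      simp [NeZero.ne m]
    · have h1 := congrFun₂ (units_zpow_mul_zpow (clockUnit_mul_pUnit m hord) n 1) 0 0
      rw [zpow_one, clockUnit_mul_apply_zero, Matrix.smul_apply, mul_clockUnit_apply_zero,
        mul_one] at h1
      have h2 : (((θ ^ n : kˣ) : k) - 1) •
          ((pUnit m (tUnit k) ^ n : (Matrix (Fin m) (Fin m) k[T;T⁻¹])ˣ) :
            Matrix (Fin m) (Fin m) k[T;T⁻¹]) 0 0 = 0 := by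
        rw [sub_smul, one_smul, ← h1, sub_self]
      rw [(smul_eq_zero.1 h2).resolve_left, map_zero, if_neg]
      · rintro rfl
        exact hd (dvd_zero _)
      · rw [sub_eq_zero, Units.val_eq_one, ← orderOf_dvd_iff_zpow_eq_one, hord]
        exact hd

end ShiftMatrix

theorem statement12 (k : Type*) [Field k] [IsAlgClosed k] [CharZero k]
    (m : ℕ) [NeZero m] (θ : kˣ) (hord : orderOf θ = m) (q s : ℤ)
    -- `g = gcd(q, m)` (so `g = m` when `q = 0`), and `s·(q/g) ≡ 1 (mod m/g)`
    (hs : s * (q / (Int.gcd q m : ℤ)) ≡ 1 [ZMOD ((m : ℤ) / (Int.gcd q m : ℤ))]) :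
    -- `L_m(Mat_m(R_1), P_m(t_1)^q, θ)` is isomorphic as a `k`-algebra to
    -- `Mat_g(Q(θ^{gs}))`
    Nonempty (
      (↥(loopAssoc k (Matrix (Fin m) (Fin m) (LaurentPolynomial k))
          ((Ad (pUnit m (tUnit k))) ^ q) θ)) ≃ₐ[k]
      Matrix (Fin (Int.gcd q m)) (Fin (Int.gcd q m))
        (QT k ((θ ^ ((Int.gcd q m : ℤ) * s) : kˣ) : k))) := by
  generalize hgcd : Int.gcd q m = g at hs ⊢
  have hm := NeZero.ne m
  obtain ⟨n, hn⟩ : g ∣ m := by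
    rw [← hgcd]
    exact_mod_cast Int.gcd_dvd_right q m
  obtain ⟨q', rfl⟩ : (g : ℤ) ∣ q := by
    rw [← hgcd]
    exact Int.gcd_dvd_left q m
  have hg0 : g ≠ 0 := by
    rintro rfl
    exact hm (by simpa using hn)
  have hn0 : n ≠ 0 := by
    rintro rfl
    exact hm (by simpa using hn)
  have hg' : (g : ℤ) ≠ 0 := by exact_mod_cast hg0
  have hmn : (m : ℤ) / g = n := by
    rw [hn, Nat.cast_mul, Int.mul_ediv_cancel_left _ hg']
  rw [Int.mul_ediv_cancel_left _ hg', hmn] at hs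
  have h := isCyclicPair_pUnit_clockUnit m hord
  have h' : IsCyclicPair θ (g * n) (pUnit m (tUnit k)) (clockUnit m θ) (cornerCoeff k m) := by
    rwa [← hn]
  exact h'.nonempty_loopAssoc_algEquiv hg0 hn0 (hord.trans hn) hs
end
end

section
/- Let θ ∈ k^× have finite order m, let R_2 = k[t_1^{±1}, t_2^{±1}] be the Laurent polynomial algebra in two variables over k, and for ε ∈ {1, −1} let ι_ε : R_2 → Q(θ^ε) be the (injective) k-algebra homomorphism with ι_ε(t_i) = x_i^m for i = 1,2. Then for every k-algebra automorphism φ of R_2 there exist ε ∈ {1, −1} and a k-algebra isomorphism ψ : Q(θ) → Q(θ^ε) such that ψ ∘ ι_1 = ι_ε ∘ φ; that is, every automorphism of R_2 extends, along the central embeddings, to an isomorphism of Q(θ) onto either Q(θ) or Q(θ^{−1}). -/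
noncomputable section

/-- Laurent polynomials in two variables `t_1, t_2` over `k`:  `R_2 = k[t_1^{±1}, t_2^{±1}]`. -/
abbrev RTwo (k : Type*) [Field k] : Type _ := AddMonoidAlgebra k (ℤ × ℤ)

open AddMonoidAlgebra

section Units

/-- In an additive monoid algebra with two unique sums, an element with a one-sided inverse is a
monomial with nonzero coefficient. -/
theorem exists_eq_single_of_mul_eq_one {k M : Type*} [Field k] [AddMonoid M] [TwoUniqueSums M]
    {f g : AddMonoidAlgebra k M} (h : f * g = 1) : ∃ (a : M) (c : kˣ), f = single a (c : k) := by
  classical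
  have hf : f ≠ 0 := by rintro rfl; simp at h
  have hg : g ≠ 0 := by rintro rfl; simp at h
  have hfc : 0 < f.coeff.support.card := by
    simpa [Finset.card_pos, Finsupp.support_nonempty_iff] using hf
  have hgc : 0 < g.coeff.support.card := by
    simpa [Finset.card_pos, Finsupp.support_nonempty_iff] using hg
  have key : ∀ p ∈ f.coeff.support ×ˢ g.coeff.support,
      UniqueAdd f.coeff.support g.coeff.support p.1 p.2 → p.1 + p.2 = 0 := by
    intro p hp hu
    rw [Finset.mem_product, Finsupp.mem_support_iff, Finsupp.mem_support_iff] at hp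
    have h1 := coeff_mul_add_of_uniqueAdd hu
    rw [h] at h1
    by_contra hne
    have h2 : (1 : AddMonoidAlgebra k M).coeff (p.1 + p.2) = 0 := by
      rw [one_def, coeff_single, Finsupp.single_eq_of_ne hne]
    exact mul_ne_zero hp.1 hp.2 (h1.symm.trans h2)
  have hle : ¬ 1 < f.coeff.support.card * g.coeff.support.card := by
    intro hlt
    obtain ⟨p, hp, q, hq, hpq, hup, huq⟩ := TwoUniqueSums.uniqueAdd_of_one_lt_card hlt
    have hsum : p.1 + p.2 = q.1 + q.2 := (key p hp hup).trans (key q hq huq).symm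
    rw [Finset.mem_product] at hp
    exact hpq (Prod.ext (huq hp.1 hp.2 hsum).1 (huq hp.1 hp.2 hsum).2)
  have hone : f.coeff.support.card = 1 := by nlinarith
  obtain ⟨a, c, hc, hac⟩ := Finsupp.card_support_eq_one'.1 hone
  refine ⟨a, Units.mk0 c hc, ?_⟩
  apply coeff_injective
  rw [hac, Units.val_mk0, coeff_single]

end Units

section Group

variable {G : Type*} [Group G] {u v z : G}

/-- If `u * v = z * (v * u)` with `z` central, then the same holds for powers. -/
theorem zpow_mul_zpow_of_mul_eq_s15 (hz : ∀ g, Commute z g) (h : u * v = z * (v * u)) (a b : ℤ) :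
    u ^ a * v ^ b = z ^ (a * b) * (v ^ b * u ^ a) := by
  have h1 : SemiconjBy u v (z * v) := by
    rw [SemiconjBy, h, mul_assoc]
  have h2 : SemiconjBy (v ^ b) (z ^ b * u) u := by
    have h3 := h1.zpow_right b
    rw [(hz v).mul_zpow] at h3
    rw [SemiconjBy, h3.eq, ← mul_assoc, ((hz (v ^ b)).zpow_left b).eq]
  have h4 := h2.zpow_right a
  rw [((hz u).zpow_left b).mul_zpow, ← zpow_mul, mul_comm b a] at h4
  rw [← h4.eq, ← mul_assoc, ← mul_assoc, ((hz (v ^ b)).zpow_left _).eq]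

/-- The commutation rule between two monomials in `u` and `v`. -/
theorem monomial_mul_monomial_of_mul_eq (hz : ∀ g, Commute z g) (h : u * v = z * (v * u))
    (a b c d : ℤ) :
    (u ^ a * v ^ b) * (u ^ c * v ^ d) =
      z ^ (a * d - b * c) * ((u ^ c * v ^ d) * (u ^ a * v ^ b)) := by
  have key : ∀ a b c d : ℤ, (u ^ a * v ^ b) * (u ^ c * v ^ d) =
      z ^ (-(b * c)) * (u ^ (a + c) * v ^ (b + d)) := by
    intro a b c d
    have h1 : v ^ b * u ^ c = z ^ (-(b * c)) * (u ^ c * v ^ b) := by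
      rw [zpow_mul_zpow_of_mul_eq_s15 hz h c b, ← mul_assoc, ← zpow_add, mul_comm c b]
      simp
    calc (u ^ a * v ^ b) * (u ^ c * v ^ d) = u ^ a * (v ^ b * u ^ c) * v ^ d := by
          simp only [mul_assoc]
      _ = (u ^ a * z ^ (-(b * c))) * (u ^ c * v ^ b * v ^ d) := by
          rw [h1]; simp only [mul_assoc]
      _ = z ^ (-(b * c)) * (u ^ (a + c) * v ^ (b + d)) := by
          rw [← ((hz (u ^ a)).zpow_left _).eq, zpow_add, zpow_add]; simp only [mul_assoc]
  rw [key a b c d, key c d a b, ← mul_assoc (z ^ (a * d - b * c)), ← zpow_add,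
    add_comm c a, add_comm d b]
  congr 2
  ring

end Group

section Scalars

variable {k : Type*} [Field k]

/-- The invertible scalars of an algebra, as units. -/
def unitScalar (A : Type*) [Ring A] [Algebra k A] : kˣ →* Aˣ :=
  Units.map (algebraMap k A).toMonoidHom

variable {A B : Type*} [Ring A] [Algebra k A] [Ring B] [Algebra k B]

theorem commute_unitScalar (r : kˣ) (g : Aˣ) : Commute (unitScalar A r) g :=
  Units.ext (Algebra.commutes (r : k) (g : A))

/-- Commutation up to a scalar is insensitive to rescaling. -/
theorem unitScalar_mul_mul_eq {u v : Aˣ} {t : kˣ} (h : u * v = unitScalar A t * (v * u))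
    (r s : kˣ) : (unitScalar A r * u) * (unitScalar A s * v) =
      unitScalar A t * ((unitScalar A s * v) * (unitScalar A r * u)) := by
  rw [(commute_unitScalar s u).symm.mul_mul_mul_comm, (commute_unitScalar r v).symm.mul_mul_mul_comm,
    h, ← map_mul, ← map_mul, ← mul_assoc (unitScalar A (r * s)), ← map_mul,
    ← mul_assoc (unitScalar A t), ← map_mul, mul_comm t, mul_comm r]

/-- The map induced on units by an algebra homomorphism. -/
def mapUnits (f : A →ₐ[k] B) : Aˣ →* Bˣ := Units.map (f : A →* B)

theorem mapUnits_comp {C : Type*} [Ring C] [Algebra k C] (g : B →ₐ[k] C) (f : A →ₐ[k] B) (u : Aˣ) :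
    mapUnits (g.comp f) u = mapUnits g (mapUnits f u) := rfl

theorem mapUnits_id (u : Aˣ) : mapUnits (AlgHom.id k A) u = u := rfl

theorem mapUnits_unitScalar (f : A →ₐ[k] B) (r : kˣ) :
    mapUnits f (unitScalar A r) = unitScalar B r :=
  Units.ext (f.commutes (r : k))

instance normal_range_unitScalar : (unitScalar (k := k) A).range.Normal where
  conj_mem := by
    rintro _ ⟨r, rfl⟩ g
    rw [← (commute_unitScalar r g).eq, mul_inv_cancel_right]
    exact ⟨r, rfl⟩

theorem exists_unitScalar_mul_eq {u v : Aˣ}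
    (h : (u : Aˣ ⧸ (unitScalar (k := k) A).range) = v) : ∃ r : kˣ, u = unitScalar A r * v := by
  obtain ⟨r, hr⟩ := QuotientGroup.eq.1 h
  refine ⟨r⁻¹, ?_⟩
  rw [← ((commute_unitScalar _ v)).eq.symm, map_inv, hr]
  simp

/-- A product of powers of monomials in two units that commute up to a scalar is, up to a scalar,
the monomial with the expected exponents. -/
theorem exists_monomial_zpow_mul {u v : Aˣ} {t : kˣ} (h : u * v = unitScalar A t * (v * u))
    (p q p' q' a b : ℤ) (s s' : kˣ) :
    ∃ r : kˣ, (unitScalar A s * (u ^ p * v ^ q)) ^ a * (unitScalar A s' * (u ^ p' * v ^ q')) ^ b =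
      unitScalar A r * (u ^ (p * a + p' * b) * v ^ (q * a + q' * b)) := by
  apply exists_unitScalar_mul_eq
  have hs : ∀ s : kˣ, ((unitScalar A s : Aˣ) : Aˣ ⧸ (unitScalar (k := k) A).range) = 1 :=
    fun s ↦ (QuotientGroup.eq_one_iff _).2 ⟨s, rfl⟩
  have hc : Commute (u : Aˣ ⧸ (unitScalar (k := k) A).range) v := by
    have := congrArg (QuotientGroup.mk (s := (unitScalar (k := k) A).range)) h
    simpa only [QuotientGroup.mk_mul, hs, one_mul, commute_iff_eq] using this
  simp only [QuotientGroup.mk_mul, QuotientGroup.mk_zpow, hs, one_mul]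
  rw [(hc.zpow_zpow p q).mul_zpow, (hc.zpow_zpow p' q').mul_zpow, zpow_add, zpow_add]
  simp only [← zpow_mul]
  exact (hc.symm.zpow_zpow (q * a) (p' * b)).mul_mul_mul_comm _ _

/-- Value on monomials of a homomorphism from the Laurent polynomials. -/
theorem map_single_eq {f : RTwo k →ₐ[k] A} {u v : Aˣ} (hu : f (single ((1, 0) : ℤ × ℤ) 1) = u)
    (hv : f (single ((0, 1) : ℤ × ℤ) 1) = v) (a b : ℤ) (c : kˣ) :
    f (single (a, b) (c : k)) = ((unitScalar A c * (u ^ a * v ^ b) : Aˣ) : A) := by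
  let F : Multiplicative (ℤ × ℤ) →* Aˣ :=
    ((f : RTwo k →* A).comp (AddMonoidAlgebra.of k (ℤ × ℤ))).toHomUnits
  have hF : ∀ x : ℤ × ℤ, (F (Multiplicative.ofAdd x) : A) = f (single x 1) := fun x ↦ rfl
  have h1 : F (Multiplicative.ofAdd (1, 0)) = u := Units.ext ((hF _).trans hu)
  have h2 : F (Multiplicative.ofAdd (0, 1)) = v := Units.ext ((hF _).trans hv)
  have h3 : F (Multiplicative.ofAdd (a, b)) = u ^ a * v ^ b := by
    rw [← h1, ← h2, ← map_zpow F, ← map_zpow F, ← map_mul F, ← ofAdd_zsmul, ← ofAdd_zsmul,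
      ← ofAdd_add]
    simp
  have h4 : (single (a, b) (c : k) : RTwo k) = (c : k) • single (a, b) 1 := by
    rw [smul_single, smul_eq_mul, mul_one]
  rw [h4, map_smul, ← hF, h3, Units.val_mul, Algebra.smul_def]
  rfl

/-- A homomorphism from the Laurent polynomials is determined by the images of the variables. -/
theorem RTwo.algHom_ext {f g : RTwo k →ₐ[k] A}
    (h1 : f (single ((1, 0) : ℤ × ℤ) 1) = g (single ((1, 0) : ℤ × ℤ) 1))
    (h2 : f (single ((0, 1) : ℤ × ℤ) 1) = g (single ((0, 1) : ℤ × ℤ) 1)) : f = g := by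
  have hunit : ∀ x : ℤ × ℤ, ∃ u : Aˣ, f (single x 1) = u := fun x ↦
    ⟨((f : RTwo k →* A).comp (AddMonoidAlgebra.of k (ℤ × ℤ))).toHomUnits (Multiplicative.ofAdd x),
      rfl⟩
  obtain ⟨u, hu⟩ := hunit (1, 0)
  obtain ⟨v, hv⟩ := hunit (0, 1)
  refine AddMonoidAlgebra.algHom_ext (fun x ↦ ?_) (Subsingleton.elim _ _)
  have hf := map_single_eq hu hv x.1 x.2 1
  have hg := map_single_eq (h1.symm.trans hu) (h2.symm.trans hv) x.1 x.2 1
  exact hf.trans hg.symm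

/-- An automorphism of the Laurent polynomials sends each variable to an invertible scalar times a
monomial, and the matrix of exponents has determinant `1` or `-1`. -/
theorem RTwo.exists_map_single (φ : RTwo k ≃ₐ[k] RTwo k) :
    ∃ (a b c d : ℤ) (r s : kˣ), φ (single ((1, 0) : ℤ × ℤ) 1) = single (a, b) (r : k) ∧
      φ (single ((0, 1) : ℤ × ℤ) 1) = single (c, d) (s : k) ∧
      (a * d - b * c = 1 ∨ a * d - b * c = -1) := by
  have hmon : ∀ (φ : RTwo k ≃ₐ[k] RTwo k) (x : ℤ × ℤ), ∃ (y : ℤ × ℤ) (r : kˣ),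
      φ (single x 1) = single y (r : k) := by
    intro φ x
    refine exists_eq_single_of_mul_eq_one (g := φ (single (-x) 1)) ?_
    rw [← map_mul, single_mul_single, add_neg_cancel, one_mul, ← one_def, map_one]
  obtain ⟨⟨a, b⟩, r, h1⟩ := hmon φ (1, 0)
  obtain ⟨⟨c, d⟩, s, h2⟩ := hmon φ (0, 1)
  have hexp : ∀ p q : ℤ, ∀ t : kˣ, ∃ t' : kˣ, φ (single (p, q) (t : k)) =
      single (a * p + c * q, b * p + d * q) (t' : k) := by
    intro p q t
    have hunit : ∀ x : ℤ × ℤ, ∃ u : (RTwo k)ˣ, (single x 1 : RTwo k) = u := fun x ↦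
      ⟨(AddMonoidAlgebra.of k (ℤ × ℤ)).toHomUnits (Multiplicative.ofAdd x), rfl⟩
    obtain ⟨u, hu⟩ := hunit (1, 0)
    obtain ⟨v, hv⟩ := hunit (0, 1)
    have hid := map_single_eq (f := AlgHom.id k (RTwo k)) hu hv
    have hφ := map_single_eq (k := k) (f := φ.toAlgHom)
      (h1.trans (hid a b r)) (h2.trans (hid c d s)) p q t
    have huv : u * v = unitScalar (RTwo k) (1 : kˣ) * (v * u) := by
      rw [map_one (unitScalar (RTwo k)), one_mul, mul_comm]
    obtain ⟨w, hw⟩ := exists_monomial_zpow_mul (k := k) huv a b c d p q r s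
    rw [hw, ← mul_assoc, ← map_mul (unitScalar (RTwo k))] at hφ
    exact ⟨t * w, hφ.trans (hid _ _ _).symm⟩
  obtain ⟨⟨p, q⟩, t, h3⟩ := hmon φ.symm (1, 0)
  obtain ⟨⟨p', q'⟩, t', h4⟩ := hmon φ.symm (0, 1)
  have hinj : ∀ (x y : ℤ × ℤ) (w : kˣ), (single x 1 : RTwo k) = single y (w : k) → x = y := by
    intro x y w hxy
    by_contra hne
    have := congrArg (fun f : RTwo k ↦ f.coeff x) hxy
    simp [Finsupp.single_eq_of_ne hne] at this
  obtain ⟨w, hw⟩ := hexp p q t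
  obtain ⟨w', hw'⟩ := hexp p' q' t'
  rw [← h3, AlgEquiv.apply_symm_apply] at hw
  rw [← h4, AlgEquiv.apply_symm_apply] at hw'
  have e1 := hinj _ _ _ hw
  have e2 := hinj _ _ _ hw'
  simp only [Prod.mk.injEq] at e1 e2
  refine ⟨a, b, c, d, r, s, h1, h2, ?_⟩
  have hdet : (a * d - b * c) * (p * q' - q * p') = 1 := by
    linear_combination -(b * p' + d * q') * e1.1 - e2.2 + (b * p + d * q) * e2.1
  exact Int.eq_one_or_neg_one_of_mul_eq_one hdet

end Scalars

section QuantumTorus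

variable {k : Type*} [Field k]

theorem qx_zero_mul_two (t : k) : qx k t 0 * qx k t 2 = 1 := by
  simpa only [qx, map_mul, map_one] using RingQuot.mkAlgHom_rel k (QRel.inv_one (k := k) (θ := t))

theorem qx_two_mul_zero (t : k) : qx k t 2 * qx k t 0 = 1 := by
  simpa only [qx, map_mul, map_one] using RingQuot.mkAlgHom_rel k (QRel.inv_one' (k := k) (θ := t))

theorem qx_one_mul_three (t : k) : qx k t 1 * qx k t 3 = 1 := by
  simpa only [qx, map_mul, map_one] using RingQuot.mkAlgHom_rel k (QRel.inv_two (k := k) (θ := t))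

theorem qx_three_mul_one (t : k) : qx k t 3 * qx k t 1 = 1 := by
  simpa only [qx, map_mul, map_one] using RingQuot.mkAlgHom_rel k (QRel.inv_two' (k := k) (θ := t))

theorem qx_zero_mul_one (t : k) :
    qx k t 0 * qx k t 1 = algebraMap k (QT k t) t * (qx k t 1 * qx k t 0) := by
  simpa only [qx, map_mul, AlgHom.commutes] using
    RingQuot.mkAlgHom_rel k (QRel.q_comm (k := k) (θ := t))

/-- The generator `x_1` of the quantum torus as a unit. -/
def qX (t : k) : (QT k t)ˣ := ⟨qx k t 0, qx k t 2, qx_zero_mul_two t, qx_two_mul_zero t⟩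

/-- The generator `x_2` of the quantum torus as a unit. -/
def qY (t : k) : (QT k t)ˣ := ⟨qx k t 1, qx k t 3, qx_one_mul_three t, qx_three_mul_one t⟩

theorem coe_qX (t : k) : (qX t : QT k t) = qx k t 0 := rfl

theorem coe_qY (t : k) : (qY t : QT k t) = qx k t 1 := rfl

theorem qX_mul_qY (t : kˣ) :
    qX (t : k) * qY (t : k) = unitScalar (QT k (t : k)) t * (qY (t : k) * qX (t : k)) :=
  Units.ext (qx_zero_mul_one (t : k))

variable {A : Type*} [Ring A] [Algebra k A]

/-- The universal property of the quantum torus. -/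
theorem QT.exists_algHom {t : kˣ} {u v : Aˣ} (h : u * v = unitScalar A t * (v * u)) :
    ∃ f : QT k (t : k) →ₐ[k] A, mapUnits f (qX (t : k)) = u ∧ mapUnits f (qY (t : k)) = v := by
  let g : FreeAlgebra k (Fin 4) →ₐ[k] A :=
    FreeAlgebra.lift k ![(u : A), (v : A), ((u⁻¹ : Aˣ) : A), ((v⁻¹ : Aˣ) : A)]
  have hg : ∀ ⦃x y⦄, QRel k (t : k) x y → g x = g y := by
    rintro _ _ (_ | _)
    · simp [g]
    · simp [g]
    · simp [g]
    · simp [g]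
    · simpa [g, unitScalar] using congrArg Units.val h
  refine ⟨RingQuot.liftAlgHom k ⟨g, hg⟩, Units.ext ?_, Units.ext ?_⟩
  · exact (RingQuot.liftAlgHom_mkAlgHom_apply k g hg _).trans (by simp [g])
  · exact (RingQuot.liftAlgHom_mkAlgHom_apply k g hg _).trans (by simp [g])

/-- A homomorphism from the quantum torus is determined by the images of `x_1` and `x_2`. -/
theorem QT.algHom_ext {t : k} {f g : QT k t →ₐ[k] A} (h1 : mapUnits f (qX t) = mapUnits g (qX t))
    (h2 : mapUnits f (qY t) = mapUnits g (qY t)) : f = g := by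
  apply RingQuot.ringQuot_ext'
  ext i
  fin_cases i
  · exact congrArg Units.val h1
  · exact congrArg Units.val h2
  · exact congrArg (fun u : Aˣ ↦ ((u⁻¹ : Aˣ) : A)) h1
  · exact congrArg (fun u : Aˣ ↦ ((u⁻¹ : Aˣ) : A)) h2

/-- Rescaling the generators by invertible scalars is bijective. -/
theorem QT.bijective_of_rescale {t : kˣ} {f : QT k (t : k) →ₐ[k] QT k (t : k)} {r s : kˣ}
    (h1 : mapUnits f (qX (t : k)) = unitScalar _ r * qX (t : k))
    (h2 : mapUnits f (qY (t : k)) = unitScalar _ s * qY (t : k)) : Function.Bijective f := by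
  have hcomm := unitScalar_mul_mul_eq (qX_mul_qY t) r⁻¹ s⁻¹
  obtain ⟨g, hg1, hg2⟩ := QT.exists_algHom hcomm
  have hgf : g.comp f = AlgHom.id k _ := by
    apply QT.algHom_ext
    · rw [mapUnits_comp, h1, map_mul, mapUnits_unitScalar, hg1, ← mul_assoc, ← map_mul]
      simp [mapUnits_id]
    · rw [mapUnits_comp, h2, map_mul, mapUnits_unitScalar, hg2, ← mul_assoc, ← map_mul]
      simp [mapUnits_id]
  have hfg : f.comp g = AlgHom.id k _ := by
    apply QT.algHom_ext
    · rw [mapUnits_comp, hg1, map_mul, mapUnits_unitScalar, h1, ← mul_assoc, ← map_mul]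
      simp [mapUnits_id]
    · rw [mapUnits_comp, hg2, map_mul, mapUnits_unitScalar, h2, ← mul_assoc, ← map_mul]
      simp [mapUnits_id]
  exact Function.bijective_iff_has_inverse.2
    ⟨g, fun x ↦ DFunLike.congr_fun hgf x, fun x ↦ DFunLike.congr_fun hfg x⟩

/-- Scaled monomials in the quantum torus of parameter `t'` whose exponent matrix has determinant
`n` define a homomorphism from the quantum torus of parameter `t' ^ n`. -/
theorem QT.exists_monomial_algHom {t t' : kˣ} {a b c d : ℤ} (h : t' ^ (a * d - b * c) = t)
    (r s : kˣ) :
    ∃ f : QT k (t : k) →ₐ[k] QT k (t' : k),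
      mapUnits f (qX (t : k)) = unitScalar _ r * (qX (t' : k) ^ a * qY (t' : k) ^ b) ∧
      mapUnits f (qY (t : k)) = unitScalar _ s * (qX (t' : k) ^ c * qY (t' : k) ^ d) := by
  apply QT.exists_algHom
  have hm := monomial_mul_monomial_of_mul_eq (commute_unitScalar t') (qX_mul_qY t') a b c d
  rw [← map_zpow, h] at hm
  exact unitScalar_mul_mul_eq hm r s

/-- If the exponent matrices of two monomial homomorphisms are inverse to each other, then their
composition is bijective. -/
theorem QT.bijective_comp {t t' : kˣ} {f : QT k (t : k) →ₐ[k] QT k (t' : k)}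
    {g : QT k (t' : k) →ₐ[k] QT k (t : k)} {a b c d p q p' q' : ℤ} {r s r' s' : kˣ}
    (hf1 : mapUnits f (qX (t : k)) = unitScalar _ r * (qX (t' : k) ^ a * qY (t' : k) ^ b))
    (hf2 : mapUnits f (qY (t : k)) = unitScalar _ s * (qX (t' : k) ^ c * qY (t' : k) ^ d))
    (hg1 : mapUnits g (qX (t' : k)) = unitScalar _ r' * (qX (t : k) ^ p * qY (t : k) ^ q))
    (hg2 : mapUnits g (qY (t' : k)) = unitScalar _ s' * (qX (t : k) ^ p' * qY (t : k) ^ q'))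
    (h1 : p * a + p' * b = 1) (h2 : q * a + q' * b = 0)
    (h3 : p * c + p' * d = 0) (h4 : q * c + q' * d = 1) : Function.Bijective (g ∘ f) := by
  obtain ⟨w, hw⟩ := exists_monomial_zpow_mul (qX_mul_qY t) p q p' q' a b r' s'
  obtain ⟨w', hw'⟩ := exists_monomial_zpow_mul (qX_mul_qY t) p q p' q' c d r' s'
  refine QT.bijective_of_rescale (f := g.comp f) (r := r * w) (s := s * w') ?_ ?_
  · rw [mapUnits_comp, hf1, map_mul, map_mul, map_zpow, map_zpow, mapUnits_unitScalar, hg1, hg2, hw,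
      h1, h2, zpow_one, zpow_zero, mul_one, map_mul, mul_assoc]
  · rw [mapUnits_comp, hf2, map_mul, map_mul, map_zpow, map_zpow, mapUnits_unitScalar, hg1, hg2,
      hw', h3, h4, zpow_one, zpow_zero, one_mul, map_mul, mul_assoc]

/-- An integer matrix of determinant `n = ±1` and two invertible scalars determine an isomorphism
from the quantum torus of parameter `t` to that of parameter `t ^ n`. -/
theorem QT.exists_algEquiv {t t' : kˣ} {a b c d n : ℤ} (hdet : a * d - b * c = n) (hn : n * n = 1)
    (h : t ^ n = t') (r s : kˣ) :
    ∃ f : QT k (t : k) ≃ₐ[k] QT k (t' : k),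
      f (qx k (t : k) 0) =
        ((unitScalar _ r * (qX (t' : k) ^ a * qY (t' : k) ^ b) : (QT k (t' : k))ˣ) : QT k (t' : k)) ∧
      f (qx k (t : k) 1) =
        ((unitScalar _ s * (qX (t' : k) ^ c * qY (t' : k) ^ d) : (QT k (t' : k))ˣ) : QT k (t' : k)) := by
  have h' : t' ^ n = t := by rw [← h, ← zpow_mul, hn, zpow_one]
  obtain ⟨f, hf1, hf2⟩ := QT.exists_monomial_algHom (t := t) (t' := t') (a := a) (b := b) (c := c)
    (d := d) (by rw [hdet, h']) r s
  obtain ⟨g, hg1, hg2⟩ := QT.exists_monomial_algHom (t := t') (t' := t) (a := n * d) (b := -(n * b))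
    (c := -(n * c)) (d := n * a) (by rw [← h]; congr 1; linear_combination n * n * hdet + n * hn)
    1 1
  have hgf := QT.bijective_comp hf1 hf2 hg1 hg2 (by linear_combination n * hdet + hn) (by ring)
    (by ring) (by linear_combination n * hdet + hn)
  have hfg := QT.bijective_comp hg1 hg2 hf1 hf2 (by linear_combination n * hdet + hn) (by ring)
    (by ring) (by linear_combination n * hdet + hn)
  exact ⟨AlgEquiv.ofBijective f ⟨hgf.1.of_comp, hfg.2.of_comp⟩, congrArg Units.val hf1,
    congrArg Units.val hf2⟩

/-- An automorphism of the Laurent polynomials whose exponent matrix has determinant `n = ±1`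
extends to an isomorphism of quantum tori of parameters `t` and `t ^ n`. -/
theorem QT.exists_algEquiv_extending [IsAlgClosed k] {t t' : kˣ} {m : ℕ} (hm : 0 < m)
    {ι : RTwo k →ₐ[k] QT k (t : k)}
    (hι1 : ι (single ((1, 0) : ℤ × ℤ) (1 : k)) = qx k (t : k) 0 ^ m)
    (hι2 : ι (single ((0, 1) : ℤ × ℤ) (1 : k)) = qx k (t : k) 1 ^ m)
    {ι' : RTwo k →ₐ[k] QT k (t' : k)}
    (hι'1 : ι' (single ((1, 0) : ℤ × ℤ) (1 : k)) = qx k (t' : k) 0 ^ m)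
    (hι'2 : ι' (single ((0, 1) : ℤ × ℤ) (1 : k)) = qx k (t' : k) 1 ^ m)
    {φ : RTwo k ≃ₐ[k] RTwo k} {a b c d n : ℤ} {r s : kˣ}
    (hφ1 : φ (single ((1, 0) : ℤ × ℤ) 1) = single (a, b) (r : k))
    (hφ2 : φ (single ((0, 1) : ℤ × ℤ) 1) = single (c, d) (s : k))
    (hdet : a * d - b * c = n) (hn : n * n = 1) (h : t ^ n = t') :
    ∃ ψ : QT k (t : k) ≃ₐ[k] QT k (t' : k), ∀ x : RTwo k, ψ (ι x) = ι' (φ x) := by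
  have hroot : ∀ (a b : ℤ) (r : kˣ), ∃ w : kˣ,
      (unitScalar _ w * (qX (t' : k) ^ a * qY (t' : k) ^ b)) ^ m =
        unitScalar _ r * ((qX (t' : k) ^ m) ^ a * (qY (t' : k) ^ m) ^ b) := by
    intro a b r
    obtain ⟨e, he⟩ := exists_monomial_zpow_mul (qX_mul_qY t') a b 0 0 m 0 1 1
    obtain ⟨w, hw⟩ := IsAlgClosed.exists_pow_nat_eq ((r * e⁻¹ : kˣ) : k) hm
    have hw0 : w ≠ 0 := by
      rintro rfl
      rw [zero_pow hm.ne'] at hw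
      exact (r * e⁻¹).ne_zero hw.symm
    refine ⟨Units.mk0 w hw0, ?_⟩
    have hwm : Units.mk0 w hw0 ^ m = r * e⁻¹ := Units.ext (by simpa using hw)
    simp only [map_one, one_mul, zpow_zero, mul_one, zero_mul, add_zero, zpow_natCast] at he
    rw [(commute_unitScalar _ _).mul_pow, ← map_pow, hwm, he, ← mul_assoc, ← map_mul,
      inv_mul_cancel_right, ← zpow_natCast, ← zpow_natCast, ← zpow_mul, ← zpow_mul,
      mul_comm a, mul_comm b]
  obtain ⟨w, hw⟩ := hroot a b r
  obtain ⟨w', hw'⟩ := hroot c d s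
  obtain ⟨ψ, hψ1, hψ2⟩ := QT.exists_algEquiv hdet hn h w w'
  have hι'1u : ι' (single ((1, 0) : ℤ × ℤ) (1 : k)) = ((qX (t' : k) ^ m : (QT k (t' : k))ˣ) :
      QT k (t' : k)) := by
    rw [hι'1, Units.val_pow_eq_pow_val, coe_qX]
  have hι'2u : ι' (single ((0, 1) : ℤ × ℤ) (1 : k)) = ((qY (t' : k) ^ m : (QT k (t' : k))ˣ) :
      QT k (t' : k)) := by
    rw [hι'2, Units.val_pow_eq_pow_val, coe_qY]
  have key : ψ.toAlgHom.comp ι = ι'.comp φ.toAlgHom := by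
    apply RTwo.algHom_ext
    · change ψ (ι _) = ι' (φ _)
      rw [hι1, hφ1, map_pow, hψ1, map_single_eq hι'1u hι'2u, ← hw, Units.val_pow_eq_pow_val]
    · change ψ (ι _) = ι' (φ _)
      rw [hι2, hφ2, map_pow, hψ2, map_single_eq hι'1u hι'2u, ← hw', Units.val_pow_eq_pow_val]
  exact ⟨ψ, fun x ↦ DFunLike.congr_fun key x⟩

end QuantumTorus

theorem statement15 (k : Type*) [Field k] [IsAlgClosed k] [CharZero k]
    (θ : kˣ) (m : ℕ) (hm : 0 < m) (hord : orderOf θ = m)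
    -- `ι_1 : R_2 → Q(θ)`, the central embedding with `t_1 ↦ x_1^m`, `t_2 ↦ x_2^m`
    (ιp : RTwo k →ₐ[k] QT k (θ : k))
    (hιp1 : ιp (AddMonoidAlgebra.single ((1, 0) : ℤ × ℤ) (1 : k)) = qx k (θ : k) 0 ^ m)
    (hιp2 : ιp (AddMonoidAlgebra.single ((0, 1) : ℤ × ℤ) (1 : k)) = qx k (θ : k) 1 ^ m)
    -- `ι_{-1} : R_2 → Q(θ⁻¹)`, the central embedding with `t_1 ↦ x_1^m`, `t_2 ↦ x_2^m`
    (ιm : RTwo k →ₐ[k] QT k ((θ⁻¹ : kˣ) : k))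
    (hιm1 : ιm (AddMonoidAlgebra.single ((1, 0) : ℤ × ℤ) (1 : k))
      = qx k ((θ⁻¹ : kˣ) : k) 0 ^ m)
    (hιm2 : ιm (AddMonoidAlgebra.single ((0, 1) : ℤ × ℤ) (1 : k))
      = qx k ((θ⁻¹ : kˣ) : k) 1 ^ m)
    -- any `k`-algebra automorphism `φ` of `R_2`
    (φ : RTwo k ≃ₐ[k] RTwo k) :
    -- extends along the central embeddings to an isomorphism of `Q(θ)` onto
    -- either `Q(θ)` or `Q(θ⁻¹)`
    (∃ ψ : QT k (θ : k) ≃ₐ[k] QT k (θ : k), ∀ r : RTwo k, ψ (ιp r) = ιp (φ r)) ∨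
    (∃ ψ : QT k (θ : k) ≃ₐ[k] QT k ((θ⁻¹ : kˣ) : k), ∀ r : RTwo k, ψ (ιp r) = ιm (φ r)) := by
  obtain ⟨a, b, c, d, r, s, hφ1, hφ2, hdet | hdet⟩ := RTwo.exists_map_single φ
  · exact Or.inl (QT.exists_algEquiv_extending hm hιp1 hιp2 hιp1 hιp2 hφ1 hφ2 hdet (by norm_num)
      (zpow_one θ))
  · exact Or.inr (QT.exists_algEquiv_extending hm hιp1 hιp2 hιm1 hιm2 hφ1 hφ2 hdet (by norm_num)
      (zpow_neg_one θ))
end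
end

section
/- Let θ ∈ k^× have finite order m. Then the cyclic algebra (t_1, t_2; m, K_2, θ) is a central division algebra of dimension m² over K_2: it is a division ring, its centre is K_2·1, and its dimension as a K_2-vector space is m². -/
noncomputable section

/-- `K_2 = k(t_1, t_2)`, the field of rational functions in two variables over `k`. -/
abbrev KTwo (k : Type*) [Field k] : Type _ := FractionRing (MvPolynomial (Fin 2) k)

/-- The images `t_1, t_2` of the two variables in `K_2`. -/
def tv (k : Type*) [Field k] (i : Fin 2) : KTwo k :=
  algebraMap (MvPolynomial (Fin 2) k) (KTwo k) (MvPolynomial.X i)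


/-- The defining relations of the cyclic algebra `(u_1, u_2; m, K_2, θ)`:
`y_1 y_2 = θ y_2 y_1`, `y_1^m = u_1` and `y_2^m = u_2`, where `y_1, y_2` are the images
of the indices `0, 1`. -/
inductive CycRel (k : Type*) [Field k] (m : ℕ) (θ : k) (u₁ u₂ : KTwo k) :
    FreeAlgebra (KTwo k) (Fin 2) → FreeAlgebra (KTwo k) (Fin 2) → Prop
  | q_comm : CycRel k m θ u₁ u₂
      (FreeAlgebra.ι (KTwo k) 0 * FreeAlgebra.ι (KTwo k) 1)
      (algebraMap (KTwo k) (FreeAlgebra (KTwo k) (Fin 2)) (algebraMap k (KTwo k) θ) *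
        (FreeAlgebra.ι (KTwo k) 1 * FreeAlgebra.ι (KTwo k) 0))
  | pow_one : CycRel k m θ u₁ u₂ (FreeAlgebra.ι (KTwo k) 0 ^ m)
      (algebraMap (KTwo k) (FreeAlgebra (KTwo k) (Fin 2)) u₁)
  | pow_two : CycRel k m θ u₁ u₂ (FreeAlgebra.ι (KTwo k) 1 ^ m)
      (algebraMap (KTwo k) (FreeAlgebra (KTwo k) (Fin 2)) u₂)

/-- The cyclic algebra `(u_1, u_2; m, K_2, θ)`. -/
abbrev CyclicAlg (k : Type*) [Field k] (m : ℕ) (θ : k) (u₁ u₂ : KTwo k) : Type _ :=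
  RingQuot (CycRel k m θ u₁ u₂)

/-- Simultaneous eigenvectors of a family of endomorphisms with pairwise distinct systems of
eigenvalues are linearly independent. -/
theorem linearIndependent_of_simultaneous_eigenvectors {K V ι κ : Type*} [Field K]
    [AddCommGroup V] [Module K V] (S : κ → Module.End K V) (χ : ι → κ → K)
    (hχ : Function.Injective χ) (v : ι → V) (hv : ∀ i, v i ≠ 0)
    (hS : ∀ i j, S j (v i) = χ i j • v i) : LinearIndependent K v := by
  classical
  rw [linearIndependent_iff']
  intro s
  induction s using Finset.induction_on with
  | empty => simp
  | insert a s ha ih =>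
    intro c hc
    have key : ∀ b ∈ s, c b = 0 := by
      intro b hb
      have hab : χ b ≠ χ a := fun h => ha (hχ h ▸ hb)
      obtain ⟨j, hj⟩ := Function.ne_iff.mp hab
      have h1 : (S j - χ a j • 1) (∑ i ∈ insert a s, c i • v i) = 0 := by rw [hc, map_zero]
      have h2 : ∑ i ∈ s, (c i * (χ i j - χ a j)) • v i = 0 := by
        rw [map_sum, Finset.sum_insert ha] at h1
        simpa [hS, ← sub_smul, smul_smul, ← smul_sub] using h1
      exact (mul_eq_zero.mp (ih _ h2 b hb)).resolve_right (sub_ne_zero.mpr hj)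
    have hca : c a = 0 := by
      rw [Finset.sum_insert ha, Finset.sum_eq_zero fun b hb => by rw [key b hb, zero_smul],
        add_zero] at hc
      exact (smul_eq_zero.mp hc).resolve_right (hv a)
    intro i hi
    rcases Finset.mem_insert.mp hi with rfl | hi
    · exact hca
    · exact key i hi

/-- If linearly independent elements multiply as in a twisted semigroup algebra over a semigroup
with unique sums, then products of nonzero linear combinations of them are nonzero. -/
theorem linearCombination_mul_ne_zero_of_twisted {k A G : Type*} [Field k] [Ring A] [Algebra k A]
    [Add G] [UniqueSums G] (w : G → A) (hw : LinearIndependent k w) (c : G → G → k)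
    (hc : ∀ p q, c p q ≠ 0) (hmul : ∀ p q, w p * w q = c p q • w (p + q))
    {f g : G →₀ k} (hf : f ≠ 0) (hg : g ≠ 0) :
    Finsupp.linearCombination k w f * Finsupp.linearCombination k w g ≠ 0 := by
  classical
  intro h
  obtain ⟨p, hp, q, hq, hpq⟩ := UniqueSums.uniqueAdd_of_nonempty
    (Finsupp.support_nonempty_iff.mpr hf) (Finsupp.support_nonempty_iff.mpr hg)
  have hprod : Finsupp.linearCombination k w (∑ a ∈ f.support, ∑ b ∈ g.support,
      Finsupp.single (a + b) (f a * g b * c a b)) = 0 := by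
    rw [← h, Finsupp.linearCombination_apply k f, Finsupp.linearCombination_apply k g,
      Finsupp.sum, Finsupp.sum, Finset.sum_mul_sum, map_sum]
    refine Finset.sum_congr rfl fun a _ => ?_
    rw [map_sum]
    refine Finset.sum_congr rfl fun b _ => ?_
    rw [Finsupp.linearCombination_single, smul_mul_smul_comm, hmul, smul_smul]
  have h0 := DFunLike.congr_fun (linearIndependent_iff.mp hw _ hprod) (p + q)
  rw [Finsupp.finsetSum_apply, Finset.sum_eq_single p, Finsupp.finsetSum_apply,
    Finset.sum_eq_single q] at h0
  · rw [Finsupp.single_eq_same] at h0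
    exact mul_ne_zero (mul_ne_zero (Finsupp.mem_support_iff.mp hp)
      (Finsupp.mem_support_iff.mp hq)) (hc p q) h0
  · intro b hb hbq
    exact Finsupp.single_eq_of_ne fun e => hbq (hpq hp hb e.symm).2
  · exact fun hq' => (hq' hq).elim
  · intro a ha hap
    rw [Finsupp.finsetSum_apply]
    refine Finset.sum_eq_zero fun b hb => ?_
    exact Finsupp.single_eq_of_ne fun e => hap (hpq ha hb e.symm).1
  · exact fun hp' => (hp' hp).elim

section QuantumCommutation

variable {R A : Type*} [CommRing R] [Ring A] [Algebra R A]

theorem pow_mul_pow_of_qcomm {q : R} {x y : A} (h : x * y = q • (y * x)) (a b : ℕ) :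
    x ^ a * y ^ b = q ^ (a * b) • (y ^ b * x ^ a) := by
  have h1 : ∀ a : ℕ, x ^ a * y = q ^ a • (y * x ^ a) := by
    intro a
    induction a with
    | zero => simp
    | succ a ih =>
      rw [pow_succ, mul_assoc, h, mul_smul_comm, ← mul_assoc, ih, smul_mul_assoc, smul_smul,
        mul_assoc, ← pow_succ']
  induction b with
  | zero => simp
  | succ b ih =>
    rw [pow_succ, ← mul_assoc, ih, smul_mul_assoc, mul_assoc, h1, mul_smul_comm, smul_smul,
      ← mul_assoc, ← pow_succ, ← pow_add, Nat.mul_succ]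

end QuantumCommutation

/-- The ordered monomials `x ^ a * y ^ b`. -/
def orderedMonomial {A : Type*} [Monoid A] (x y : A) (p : ℕ × ℕ) : A := x ^ p.1 * y ^ p.2

theorem orderedMonomial_mul {k A : Type*} [Field k] [Ring A] [Algebra k A] {q : k} (hq : q ≠ 0)
    {x y : A} (h : x * y = q • (y * x)) (p r : ℕ × ℕ) :
    orderedMonomial x y p * orderedMonomial x y r =
      (q ^ (r.1 * p.2))⁻¹ • orderedMonomial x y (p + r) := by
  have h1 : y ^ p.2 * x ^ r.1 = (q ^ (r.1 * p.2))⁻¹ • (x ^ r.1 * y ^ p.2) := by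
    rw [pow_mul_pow_of_qcomm h, smul_smul, inv_mul_cancel₀ (pow_ne_zero _ hq), one_smul]
  simp only [orderedMonomial, Prod.fst_add, Prod.snd_add]
  rw [mul_assoc, ← mul_assoc (y ^ p.2), h1, smul_mul_assoc, mul_smul_comm, pow_add, pow_add]
  simp only [mul_assoc]

section Symbol

variable {K A : Type*} [Field K] [Ring A] [Algebra K A] {q u v : K} {m : ℕ} {x y : A}

/-- The endomorphisms `z ↦ x z x ^ (m - 1)` and `z ↦ y ^ (m - 1) z y`, which are diagonal on
ordered monomials. -/
def symbolConj (K : Type*) {A : Type*} [Field K] [Ring A] [Algebra K A] (m : ℕ) (x y : A) :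
    Fin 2 → Module.End K A :=
  ![LinearMap.mulLeft K x * LinearMap.mulRight K (x ^ (m - 1)),
    LinearMap.mulLeft K (y ^ (m - 1)) * LinearMap.mulRight K y]

theorem symbolConj_orderedMonomial (h : x * y = q • (y * x)) (hm : 0 < m)
    (hx : x ^ m = algebraMap K A u) (hy : y ^ m = algebraMap K A v) (p : ℕ × ℕ) (j : Fin 2) :
    symbolConj K m x y j (orderedMonomial x y p) =
      (![q ^ p.2 * u, q ^ p.1 * v] : Fin 2 → K) j • orderedMonomial x y p := by
  obtain ⟨n, rfl⟩ : ∃ n, m = n + 1 := ⟨m - 1, by omega⟩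
  fin_cases j
  · have h1 : x * y ^ p.2 = q ^ p.2 • (y ^ p.2 * x) := by
      simpa using pow_mul_pow_of_qcomm h 1 p.2
    calc x * (x ^ p.1 * y ^ p.2 * x ^ n) = x ^ p.1 * (x * y ^ p.2) * x ^ n := by
          simp only [← mul_assoc, ← pow_succ, ← pow_succ']
      _ = q ^ p.2 • (x ^ p.1 * y ^ p.2 * x ^ (n + 1)) := by
          rw [h1, pow_succ' x n, mul_smul_comm, smul_mul_assoc]
          simp only [mul_assoc]
      _ = (q ^ p.2 * u) • (x ^ p.1 * y ^ p.2) := by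
          rw [hx, ← Algebra.commutes, ← Algebra.smul_def, smul_smul]
  · have h1 : x ^ p.1 * y = q ^ p.1 • (y * x ^ p.1) := by
      simpa using pow_mul_pow_of_qcomm h p.1 1
    calc y ^ n * (x ^ p.1 * y ^ p.2 * y) = y ^ n * (x ^ p.1 * y) * y ^ p.2 := by
          simp only [mul_assoc, ← pow_succ, ← pow_succ']
      _ = q ^ p.1 • (y ^ (n + 1) * (x ^ p.1 * y ^ p.2)) := by
          rw [h1, pow_succ y n, mul_smul_comm, smul_mul_assoc]
          simp only [mul_assoc]
      _ = (q ^ p.1 * v) • (x ^ p.1 * y ^ p.2) := by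
          rw [hy, ← Algebra.smul_def, smul_smul]

theorem symbolConj_apply_of_mem_center (hm : 0 < m)
    (hx : x ^ m = algebraMap K A u) (hy : y ^ m = algebraMap K A v) {z : A}
    (hz : ∀ b : A, b * z = z * b) (j : Fin 2) :
    symbolConj K m x y j z = (![u, v] : Fin 2 → K) j • z := by
  obtain ⟨n, rfl⟩ : ∃ n, m = n + 1 := ⟨m - 1, by omega⟩
  fin_cases j
  · change x * (z * x ^ n) = u • z
    rw [← hz, ← mul_assoc, ← pow_succ', hx, ← Algebra.smul_def]
  · change y ^ n * (z * y) = v • z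
    rw [← hz, ← mul_assoc, ← pow_succ, hy, ← Algebra.smul_def]

theorem linearIndependent_orderedMonomial [Nontrivial A] (hq : orderOf q = m)
    (h : x * y = q • (y * x)) (hm : 0 < m) (hu : u ≠ 0) (hv : v ≠ 0)
    (hx : x ^ m = algebraMap K A u) (hy : y ^ m = algebraMap K A v) :
    LinearIndependent K fun p : Fin m × Fin m => orderedMonomial x y (p.1, p.2) := by
  have hxu : IsUnit x :=
    (isUnit_pow_iff hm.ne').mp (hx ▸ (isUnit_iff_ne_zero.mpr hu).map (algebraMap K A))
  have hyu : IsUnit y :=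
    (isUnit_pow_iff hm.ne').mp (hy ▸ (isUnit_iff_ne_zero.mpr hv).map (algebraMap K A))
  refine linearIndependent_of_simultaneous_eigenvectors (symbolConj K m x y)
    (fun p : Fin m × Fin m => ![q ^ (p.2 : ℕ) * u, q ^ (p.1 : ℕ) * v]) ?_ _
    (fun p => ((hxu.pow _).mul (hyu.pow _)).ne_zero)
    (fun p j => symbolConj_orderedMonomial h hm hx hy _ j)
  have hinj : ∀ a b : Fin m, q ^ (a : ℕ) = q ^ (b : ℕ) → a = b := fun a b hab =>
    Fin.ext (pow_injOn_Iio_orderOf (hq ▸ a.2) (hq ▸ b.2) hab)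
  intro p r hpr
  have h0 := congrFun hpr 0
  have h1 := congrFun hpr 1
  exact Prod.ext (hinj _ _ (mul_right_cancel₀ hv h1)) (hinj _ _ (mul_right_cancel₀ hu h0))

theorem orderedMonomial_add_mul (hx : x ^ m = algebraMap K A u) (hy : y ^ m = algebraMap K A v)
    (a b i j : ℕ) : orderedMonomial x y (i + m * a, j + m * b) =
      (u ^ a * v ^ b) • orderedMonomial x y (i, j) := by
  simp only [orderedMonomial]
  rw [pow_add, pow_add, pow_mul, pow_mul, hx, hy, ← map_pow, ← map_pow, Algebra.smul_def,
    map_mul, ← Algebra.commutes (u ^ a), ← Algebra.commutes (v ^ b)]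
  rw [mul_assoc, mul_assoc, ← mul_assoc (x ^ i), ← Algebra.commutes (v ^ b), mul_assoc]

theorem span_orderedMonomial_eq_top (hq : q ≠ 0) (h : x * y = q • (y * x)) (hm : 0 < m)
    (hx : x ^ m = algebraMap K A u) (hy : y ^ m = algebraMap K A v)
    (hgen : Algebra.adjoin K {x, y} = ⊤) :
    Submodule.span K
      (Set.range fun p : Fin m × Fin m => orderedMonomial x y (p.1, p.2)) = ⊤ := by
  set P := Submodule.span K
    (Set.range fun p : Fin m × Fin m => orderedMonomial x y (p.1, p.2)) with hP
  have hall : ∀ p : ℕ × ℕ, orderedMonomial x y p ∈ P := by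
    rintro ⟨a, b⟩
    rw [← Nat.mod_add_div a m, ← Nat.mod_add_div b m, orderedMonomial_add_mul hx hy]
    exact P.smul_mem _ (Submodule.subset_span
      ⟨(⟨a % m, Nat.mod_lt _ hm⟩, ⟨b % m, Nat.mod_lt _ hm⟩), rfl⟩)
  have hmon : ∀ p : ℕ × ℕ, ∀ z ∈ P, orderedMonomial x y p * z ∈ P := by
    intro p z hz
    induction hz using Submodule.span_induction with
    | mem z hz =>
      obtain ⟨r, rfl⟩ := hz
      rw [orderedMonomial_mul hq h]
      exact P.smul_mem _ (hall _)
    | zero => simp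
    | add a b _ _ ha hb => rw [mul_add]; exact P.add_mem ha hb
    | smul c a _ ha => rw [mul_smul_comm]; exact P.smul_mem _ ha
  have hmul : ∀ a : A, ∀ z ∈ P, a * z ∈ P := by
    intro a
    have ha : a ∈ Algebra.adjoin K {x, y} := hgen ▸ Algebra.mem_top
    induction ha using Algebra.adjoin_induction with
    | mem a ha =>
      rcases ha with rfl | rfl
      · simpa [orderedMonomial] using hmon (1, 0)
      · simpa [orderedMonomial] using hmon (0, 1)
    | algebraMap c =>
      intro z hz
      rw [← Algebra.smul_def]
      exact P.smul_mem _ hz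
    | add a b _ _ ha hb => intro z hz; rw [add_mul]; exact P.add_mem (ha z hz) (hb z hz)
    | mul a b _ _ ha hb => intro z hz; rw [mul_assoc]; exact ha _ (hb z hz)
  refine eq_top_iff.mpr fun a _ => ?_
  have h1 : (1 : A) ∈ P := by simpa [orderedMonomial] using hall (0, 0)
  simpa using hmul a 1 h1

/-- The basis of ordered monomials `x ^ i * y ^ j`, `i, j < m`. -/
def orderedMonomialBasis [Nontrivial A] (hq : orderOf q = m) (hq0 : q ≠ 0)
    (h : x * y = q • (y * x)) (hm : 0 < m) (hu : u ≠ 0) (hv : v ≠ 0)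
    (hx : x ^ m = algebraMap K A u) (hy : y ^ m = algebraMap K A v)
    (hgen : Algebra.adjoin K {x, y} = ⊤) : Module.Basis (Fin m × Fin m) K A :=
  Module.Basis.mk (linearIndependent_orderedMonomial hq h hm hu hv hx hy)
    (span_orderedMonomial_eq_top hq0 h hm hx hy hgen).ge

theorem center_eq_bot_of_symbol [Nontrivial A] (hq : orderOf q = m) (hq0 : q ≠ 0)
    (h : x * y = q • (y * x)) (hm : 0 < m) (hu : u ≠ 0) (hv : v ≠ 0)
    (hx : x ^ m = algebraMap K A u) (hy : y ^ m = algebraMap K A v)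
    (hgen : Algebra.adjoin K {x, y} = ⊤) : Subalgebra.center K A = ⊥ := by
  refine eq_bot_iff.mpr fun z hz => ?_
  rw [Subalgebra.mem_center_iff] at hz
  set b := orderedMonomialBasis hq hq0 h hm hu hv hx hy hgen
  have hb : ∀ p, b p = orderedMonomial x y (p.1, p.2) := fun p => Module.Basis.mk_apply _ _ p
  have hz' := b.sum_repr z
  have hcoef : ∀ (j : Fin 2) (p : Fin m × Fin m),
      b.repr z p * ((![q ^ (p.2 : ℕ) * u, q ^ (p.1 : ℕ) * v] : Fin 2 → K) j -
        (![u, v] : Fin 2 → K) j) = 0 := by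
    intro j
    refine Fintype.linearIndependent_iff.mp b.linearIndependent _ ?_
    have h1 := symbolConj_apply_of_mem_center hm hx hy hz j
    rw [← sub_eq_zero, ← hz', map_sum, Finset.smul_sum, ← Finset.sum_sub_distrib] at h1
    rw [← h1]
    refine Finset.sum_congr rfl fun p _ => ?_
    rw [map_smul, hb, symbolConj_orderedMonomial h hm hx hy, smul_smul, smul_smul, ← sub_smul]
    congr 1
    ring
  have hone : ∀ a : Fin m, q ^ (a : ℕ) = 1 → (a : ℕ) = 0 := fun a ha =>
    Nat.eq_zero_of_dvd_of_lt (hq.symm.dvd.trans (orderOf_dvd_of_pow_eq_one ha)) a.2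
  have hzero : ∀ p : Fin m × Fin m, p ≠ (⟨0, hm⟩, ⟨0, hm⟩) → b.repr z p = 0 := by
    intro p hp
    by_contra hne
    have h0 := (mul_eq_zero.mp (hcoef 0 p)).resolve_left hne
    have h1 := (mul_eq_zero.mp (hcoef 1 p)).resolve_left hne
    refine hp (Prod.ext (Fin.ext (hone _ ?_)) (Fin.ext (hone _ ?_)))
    · exact mul_right_cancel₀ hv (by simpa using sub_eq_zero.mp h1)
    · exact mul_right_cancel₀ hu (by simpa using sub_eq_zero.mp h0)
  rw [← hz', Finset.sum_eq_single (⟨0, hm⟩, ⟨0, hm⟩)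
    (fun p _ hp => by rw [hzero p hp, zero_smul]) (fun hp => (hp (Finset.mem_univ _)).elim), hb]
  simpa [orderedMonomial] using
    Subalgebra.smul_mem ⊥ (one_mem (⊥ : Subalgebra K A)) (b.repr z (⟨0, hm⟩, ⟨0, hm⟩))

end Symbol

section RationalFunctions

variable {k : Type*} [Field k]

theorem tv_ne_zero (i : Fin 2) : tv k i ≠ 0 :=
  (map_ne_zero_iff _ (IsFractionRing.injective (MvPolynomial (Fin 2) k) (KTwo k))).mpr
    (MvPolynomial.X_ne_zero i)

theorem linearIndependent_tv_pow_mul_tv_pow :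
    LinearIndependent k fun p : ℕ × ℕ => tv k 0 ^ p.1 * tv k 1 ^ p.2 := by
  let e : ℕ × ℕ → Fin 2 →₀ ℕ := fun p => Finsupp.single 0 p.1 + Finsupp.single 1 p.2
  have he : Function.Injective e := by
    intro p r hpr
    have h0 := DFunLike.congr_fun hpr 0
    have h1 := DFunLike.congr_fun hpr 1
    exact Prod.ext (by simpa [e] using h0) (by simpa [e] using h1)
  have h1 := ((MvPolynomial.basisMonomials (Fin 2) k).linearIndependent.comp e he).map'
    (IsScalarTower.toAlgHom k (MvPolynomial (Fin 2) k) (KTwo k)).toLinearMap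
    (LinearMap.ker_eq_bot.mpr (IsFractionRing.injective (MvPolynomial (Fin 2) k) (KTwo k)))
  have hfun : (fun p : ℕ × ℕ => tv k 0 ^ p.1 * tv k 1 ^ p.2) =
      (IsScalarTower.toAlgHom k (MvPolynomial (Fin 2) k) (KTwo k)).toLinearMap ∘
        MvPolynomial.basisMonomials (Fin 2) k ∘ e := by
    funext p
    have hmon : MvPolynomial.monomial (e p) (1 : k) =
        MvPolynomial.X 0 ^ p.1 * MvPolynomial.X 1 ^ p.2 := by
      rw [MvPolynomial.X_pow_eq_monomial, MvPolynomial.X_pow_eq_monomial,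
        MvPolynomial.monomial_mul, one_mul]
    simp [tv, hmon]
  rw [hfun]
  exact h1

variable {A : Type*} [Ring A] [Algebra (KTwo k) A] [Algebra k A] [IsScalarTower k (KTwo k) A]
  {θ : k} {m : ℕ} {x y : A}

theorem linearIndependent_orderedMonomial_nat [Nontrivial A]
    (hθ : orderOf (algebraMap k (KTwo k) θ) = m)
    (h : x * y = algebraMap k (KTwo k) θ • (y * x)) (hm : 0 < m)
    (hx : x ^ m = algebraMap (KTwo k) A (tv k 0)) (hy : y ^ m = algebraMap (KTwo k) A (tv k 1)) :
    LinearIndependent k (orderedMonomial x y) := by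
  have h1 := linearIndependent_smul linearIndependent_tv_pow_mul_tv_pow
    (linearIndependent_orderedMonomial hθ h hm (tv_ne_zero 0) (tv_ne_zero 1) hx hy)
  let e : ℕ × ℕ → (ℕ × ℕ) × (Fin m × Fin m) := fun p =>
    ((p.1 / m, p.2 / m), (⟨p.1 % m, Nat.mod_lt _ hm⟩, ⟨p.2 % m, Nat.mod_lt _ hm⟩))
  have he : Function.Injective e := by
    rintro ⟨a, b⟩ ⟨c, d⟩ hpr
    simp only [e, Prod.mk.injEq, Fin.mk.injEq] at hpr
    obtain ⟨⟨h1, h2⟩, h3, h4⟩ := hpr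
    rw [← Nat.mod_add_div a m, ← Nat.mod_add_div b m, h1, h2, h3, h4, Nat.mod_add_div,
      Nat.mod_add_div]
  convert h1.comp e he using 1
  funext ⟨a, b⟩
  conv_lhs => rw [← Nat.mod_add_div a m, ← Nat.mod_add_div b m, orderedMonomial_add_mul hx hy]
  rfl

theorem exists_smul_mem_span_orderedMonomial
    (hx : x ^ m = algebraMap (KTwo k) A (tv k 0)) (hy : y ^ m = algebraMap (KTwo k) A (tv k 1))
    (hspan : Submodule.span (KTwo k) (Set.range (orderedMonomial x y)) = ⊤) (z : A) :
    ∃ d : MvPolynomial (Fin 2) k, d ≠ 0 ∧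
      algebraMap _ (KTwo k) d • z ∈ Submodule.span k (Set.range (orderedMonomial x y)) := by
  set W := Submodule.span k (Set.range (orderedMonomial x y)) with hW
  have htv : ∀ (i : Fin 2), ∀ w ∈ W, tv k i • w ∈ W := by
    intro i w hw
    induction hw using Submodule.span_induction with
    | mem w hw =>
      obtain ⟨⟨a, b⟩, rfl⟩ := hw
      fin_cases i
      · have := orderedMonomial_add_mul hx hy 1 0 a b
        simp only [pow_one, pow_zero, mul_one] at this
        exact Submodule.subset_span ⟨_, this⟩
      · have := orderedMonomial_add_mul hx hy 0 1 a b
        simp only [pow_one, pow_zero, one_mul] at this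
        exact Submodule.subset_span ⟨_, this⟩
    | zero => simp
    | add a b _ _ ha hb => rw [smul_add]; exact W.add_mem ha hb
    | smul c a _ ha => rw [smul_comm]; exact W.smul_mem _ ha
  have hpoly : ∀ (P : MvPolynomial (Fin 2) k), ∀ w ∈ W, algebraMap _ (KTwo k) P • w ∈ W := by
    intro P
    induction P using MvPolynomial.induction_on with
    | C c =>
      intro w hw
      rw [← MvPolynomial.algebraMap_eq, ← IsScalarTower.algebraMap_apply, algebraMap_smul]
      exact W.smul_mem _ hw
    | add P Q hP hQ =>
      intro w hw
      rw [map_add, add_smul]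
      exact W.add_mem (hP w hw) (hQ w hw)
    | mul_X P i hP =>
      intro w hw
      rw [map_mul, mul_smul]
      exact hP _ (htv i w hw)
  have hz : z ∈ Submodule.span (KTwo k) (Set.range (orderedMonomial x y)) :=
    hspan ▸ Submodule.mem_top
  induction hz using Submodule.span_induction with
  | mem z hz => exact ⟨1, one_ne_zero, by simpa using Submodule.subset_span hz⟩
  | zero => exact ⟨1, one_ne_zero, by simp⟩
  | add a b _ _ ha hb =>
    obtain ⟨d, hd, hda⟩ := ha
    obtain ⟨e, he, heb⟩ := hb
    refine ⟨d * e, mul_ne_zero hd he, ?_⟩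
    rw [smul_add]
    refine W.add_mem ?_ ?_
    · rw [mul_comm, map_mul, mul_smul]
      exact hpoly e _ hda
    · rw [map_mul, mul_smul]
      exact hpoly d _ heb
  | smul c a _ ha =>
    obtain ⟨d, hd, hda⟩ := ha
    obtain ⟨n, s, hs, rfl⟩ := IsFractionRing.div_surjective (A := MvPolynomial (Fin 2) k) c
    have hs0 : s ≠ 0 := nonZeroDivisors.ne_zero hs
    have hs1 : algebraMap _ (KTwo k) s ≠ 0 :=
      (map_ne_zero_iff _ (IsFractionRing.injective (MvPolynomial (Fin 2) k) (KTwo k))).mpr hs0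
    refine ⟨s * d, mul_ne_zero hs0 hd, ?_⟩
    have hrw : algebraMap _ (KTwo k) (s * d) • (algebraMap _ (KTwo k) n /
        algebraMap _ (KTwo k) s) • a = algebraMap _ (KTwo k) n • algebraMap _ (KTwo k) d • a := by
      rw [smul_smul, smul_smul, map_mul]
      congr 1
      field_simp
    rw [hrw]
    exact hpoly n _ hda

end RationalFunctions

theorem noZeroDivisors_of_symbol {k A : Type*} [Field k] [Ring A] [Nontrivial A]
    [Algebra (KTwo k) A] {θ : k} {m : ℕ} {x y : A}
    (hθ : orderOf (algebraMap k (KTwo k) θ) = m) (hθ0 : θ ≠ 0)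
    (h : x * y = algebraMap k (KTwo k) θ • (y * x)) (hm : 0 < m)
    (hx : x ^ m = algebraMap (KTwo k) A (tv k 0)) (hy : y ^ m = algebraMap (KTwo k) A (tv k 1))
    (hgen : Algebra.adjoin (KTwo k) {x, y} = ⊤) : NoZeroDivisors A := by
  let _ : Algebra k A := Algebra.compHom A (algebraMap k (KTwo k))
  have : IsScalarTower k (KTwo k) A := IsScalarTower.of_algebraMap_eq fun _ => rfl
  have hspan : Submodule.span (KTwo k) (Set.range (orderedMonomial x y)) = ⊤ := by
    refine eq_top_iff.mpr ((span_orderedMonomial_eq_top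
      ((map_ne_zero _).mpr hθ0) h hm hx hy hgen).ge.trans (Submodule.span_mono ?_))
    rintro _ ⟨p, rfl⟩
    exact ⟨_, rfl⟩
  have hli := linearIndependent_orderedMonomial_nat hθ h hm hx hy
  have hk : x * y = θ • (y * x) := by rw [h, algebraMap_smul]
  have hinj := IsFractionRing.injective (MvPolynomial (Fin 2) k) (KTwo k)
  refine ⟨fun {a b} hab => ?_⟩
  by_contra! hne
  obtain ⟨d, hd, hda⟩ := exists_smul_mem_span_orderedMonomial hx hy hspan a
  obtain ⟨e, he, heb⟩ := exists_smul_mem_span_orderedMonomial hx hy hspan b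
  obtain ⟨f, hf⟩ := (Finsupp.mem_span_range_iff_exists_finsupp).mp hda
  obtain ⟨g, hg⟩ := (Finsupp.mem_span_range_iff_exists_finsupp).mp heb
  have hf0 : f ≠ 0 := by
    rintro rfl
    rw [Finsupp.sum_zero_index] at hf
    exact smul_ne_zero ((map_ne_zero_iff _ hinj).mpr hd) hne.1 hf.symm
  have hg0 : g ≠ 0 := by
    rintro rfl
    rw [Finsupp.sum_zero_index] at hg
    exact smul_ne_zero ((map_ne_zero_iff _ hinj).mpr he) hne.2 hg.symm
  refine linearCombination_mul_ne_zero_of_twisted _ hli _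
    (fun p r => inv_ne_zero (pow_ne_zero _ hθ0)) (orderedMonomial_mul hθ0 hk) hf0 hg0 ?_
  rw [Finsupp.linearCombination_apply, Finsupp.linearCombination_apply, hf, hg,
    smul_mul_smul_comm, hab, smul_zero]

theorem centralDivision_of_symbol {k A : Type*} [Field k] [Ring A] [Nontrivial A]
    [Algebra (KTwo k) A] {θ : k} {m : ℕ} {x y : A}
    (hθ : orderOf (algebraMap k (KTwo k) θ) = m) (hθ0 : θ ≠ 0)
    (h : x * y = algebraMap k (KTwo k) θ • (y * x)) (hm : 0 < m)
    (hx : x ^ m = algebraMap (KTwo k) A (tv k 0)) (hy : y ^ m = algebraMap (KTwo k) A (tv k 1))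
    (hgen : Algebra.adjoin (KTwo k) {x, y} = ⊤) :
    (∀ z : A, z ≠ 0 → IsUnit z) ∧ Subalgebra.center (KTwo k) A = ⊥ ∧
      Module.Finite (KTwo k) A ∧ Module.finrank (KTwo k) A = m ^ 2 := by
  have := noZeroDivisors_of_symbol hθ hθ0 h hm hx hy hgen
  have : IsDomain A := NoZeroDivisors.to_isDomain _
  have hθ1 : algebraMap k (KTwo k) θ ≠ 0 := (map_ne_zero _).mpr hθ0
  let b := orderedMonomialBasis hθ hθ1 h hm (tv_ne_zero 0) (tv_ne_zero 1) hx hy hgen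
  have hfin : Module.Finite (KTwo k) A := Module.Finite.of_basis b
  refine ⟨fun z hz => FiniteDimensional.isUnit (KTwo k) hz,
    center_eq_bot_of_symbol hθ hθ1 h hm (tv_ne_zero 0) (tv_ne_zero 1) hx hy hgen, hfin, ?_⟩
  rw [Module.finrank_eq_card_basis b, Fintype.card_prod, Fintype.card_fin, sq]

section CyclicAlgebra

variable {k : Type*} [Field k] {m : ℕ} {u₁ u₂ : KTwo k}

/-- The generators `y_1, y_2` of the cyclic algebra. -/
def cyclicGen (m : ℕ) (θ : k) (u₁ u₂ : KTwo k) (i : Fin 2) : CyclicAlg k m θ u₁ u₂ :=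
  RingQuot.mkAlgHom (KTwo k) (CycRel k m θ u₁ u₂) (FreeAlgebra.ι (KTwo k) i)

theorem cyclicGen_comm (θ : k) :
    cyclicGen m θ u₁ u₂ 0 * cyclicGen m θ u₁ u₂ 1 =
      algebraMap k (KTwo k) θ • (cyclicGen m θ u₁ u₂ 1 * cyclicGen m θ u₁ u₂ 0) := by
  have h := RingQuot.mkAlgHom_rel (KTwo k) (CycRel.q_comm (k := k) (m := m) (θ := θ) (u₁ := u₁) (u₂ := u₂))
  rw [map_mul, map_mul, AlgHom.commutes, map_mul, ← Algebra.smul_def] at h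
  exact h

theorem cyclicGen_zero_pow (θ : k) :
    cyclicGen m θ u₁ u₂ 0 ^ m = algebraMap (KTwo k) _ u₁ := by
  have h := RingQuot.mkAlgHom_rel (KTwo k) (CycRel.pow_one (m := m) (θ := θ) (u₁ := u₁) (u₂ := u₂))
  rw [map_pow, AlgHom.commutes] at h
  exact h

theorem cyclicGen_one_pow (θ : k) :
    cyclicGen m θ u₁ u₂ 1 ^ m = algebraMap (KTwo k) _ u₂ := by
  have h := RingQuot.mkAlgHom_rel (KTwo k) (CycRel.pow_two (m := m) (θ := θ) (u₁ := u₁) (u₂ := u₂))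
  rw [map_pow, AlgHom.commutes] at h
  exact h

theorem adjoin_cyclicGen (θ : k) :
    Algebra.adjoin (KTwo k) {cyclicGen m θ u₁ u₂ 0, cyclicGen m θ u₁ u₂ 1} = ⊤ := by
  refine eq_top_iff.mpr fun z _ => ?_
  obtain ⟨f, rfl⟩ := RingQuot.mkAlgHom_surjective (KTwo k) (CycRel k m θ u₁ u₂) z
  induction f using FreeAlgebra.induction with
  | grade0 r => rw [AlgHom.commutes]; exact Subalgebra.algebraMap_mem _ r
  | grade1 i =>
    refine Algebra.subset_adjoin ?_
    fin_cases i
    · exact Or.inl rfl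
    · exact Or.inr rfl
  | mul a b ha hb => rw [map_mul]; exact mul_mem (ha Algebra.mem_top) (hb Algebra.mem_top)
  | add a b ha hb => rw [map_add]; exact add_mem (ha Algebra.mem_top) (hb Algebra.mem_top)

/-- The cyclic algebra is nonzero, because over an algebraic closure of `K_2` it acts by clock and
shift operators on functions on the `m`-th roots of unity. -/
theorem nontrivial_cyclicAlg {θ : kˣ} (hm : 0 < m) (hθ : θ ^ m = 1) :
    Nontrivial (CyclicAlg k m (θ : k) u₁ u₂) := by
  let L := AlgebraicClosure (KTwo k)
  obtain ⟨a, ha⟩ := IsAlgClosed.exists_pow_nat_eq (algebraMap (KTwo k) L u₁) hm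
  obtain ⟨b, hb⟩ := IsAlgClosed.exists_pow_nat_eq (algebraMap (KTwo k) L u₂) hm
  let G := rootsOfUnity m k
  let t : G := ⟨θ, (mem_rootsOfUnity m θ).mpr hθ⟩
  let φ : k →+* L := (algebraMap (KTwo k) L).comp (algebraMap k (KTwo k))
  let clock : Module.End (KTwo k) (G → L) :=
    { toFun := fun f c => a * φ (c : kˣ) * f c
      map_add' := fun f g => by funext c; simp [mul_add]
      map_smul' := fun r f => by funext c; simp }
  let shift : Module.End (KTwo k) (G → L) :=
    { toFun := fun f c => b * f (t⁻¹ * c)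
      map_add' := fun f g => by funext c; simp [mul_add]
      map_smul' := fun r f => by funext c; simp }
  have hclock : ∀ (n : ℕ) (f : G → L) (c : G),
      (clock ^ n) f c = a ^ n * φ ((c : kˣ) : k) ^ n * f c := by
    intro n
    induction n with
    | zero => simp
    | succ n ih =>
      intro f c
      rw [pow_succ, Module.End.mul_apply, ih]
      simp only [clock, LinearMap.coe_mk, AddHom.coe_mk]
      ring
  have hshift : ∀ (n : ℕ) (f : G → L) (c : G), (shift ^ n) f c = b ^ n * f (t⁻¹ ^ n * c) := by
    intro n
    induction n with
    | zero => simp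
    | succ n ih =>
      intro f c
      rw [pow_succ, Module.End.mul_apply, ih]
      simp only [shift, LinearMap.coe_mk, AddHom.coe_mk]
      rw [← mul_assoc t⁻¹, ← pow_succ', pow_succ b, mul_assoc]
  have htm : t ^ m = 1 := Subtype.ext (by simpa [t] using hθ)
  let F : FreeAlgebra (KTwo k) (Fin 2) →ₐ[KTwo k] Module.End (KTwo k) (G → L) :=
    FreeAlgebra.lift (KTwo k) ![clock, shift]
  have hF : ∀ ⦃f g⦄, CycRel k m (θ : k) u₁ u₂ f g → F f = F g := by
    intro f g hfg
    cases hfg with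
    | q_comm =>
      refine LinearMap.ext fun f => funext fun c => ?_
      have hc : φ ((c : kˣ) : k) = φ (θ : k) * φ (((t⁻¹ * c : G) : kˣ) : k) := by
        rw [← map_mul]
        simp [t]
      simp only [F, map_mul, AlgHom.commutes, FreeAlgebra.lift_ι_apply, Module.End.mul_apply,
        Module.algebraMap_end_apply, Matrix.cons_val_zero, Matrix.cons_val_one, Pi.smul_apply]
      simp only [clock, shift, LinearMap.coe_mk, AddHom.coe_mk]
      rw [hc, Algebra.smul_def]
      simp only [φ, RingHom.comp_apply]
      ring
    | pow_one =>
      refine LinearMap.ext fun f => funext fun c => ?_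
      have hc : φ ((c : kˣ) : k) ^ m = 1 := by
        rw [← map_pow, ← Units.val_pow_eq_pow_val, (mem_rootsOfUnity m _).mp c.2, Units.val_one,
          map_one]
      simp only [F, map_pow, AlgHom.commutes, FreeAlgebra.lift_ι_apply,
        Module.algebraMap_end_apply, Matrix.cons_val_zero, Pi.smul_apply]
      rw [hclock, hc, ha, mul_one, Algebra.smul_def]
    | pow_two =>
      refine LinearMap.ext fun f => funext fun c => ?_
      simp only [F, map_pow, AlgHom.commutes, FreeAlgebra.lift_ι_apply,
        Module.algebraMap_end_apply, Matrix.cons_val_one, Pi.smul_apply]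
      change (shift ^ m) f c = _
      rw [hshift, inv_pow, htm, inv_one, one_mul, hb, Algebra.smul_def]
  exact (RingQuot.liftAlgHom (KTwo k) ⟨F, hF⟩).toRingHom.domain_nontrivial

end CyclicAlgebra

theorem statement16 (k : Type*) [Field k] [IsAlgClosed k] [CharZero k]
    (θ : kˣ) (m : ℕ) (hm : 0 < m) (hord : orderOf θ = m) :
    -- the cyclic algebra `(t_1, t_2; m, K_2, θ)` is a division ring,
    Nontrivial (CyclicAlg k m (θ : k) (tv k 0) (tv k 1)) ∧
    (∀ x : CyclicAlg k m (θ : k) (tv k 0) (tv k 1), x ≠ 0 → IsUnit x) ∧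
    -- its centre is `K_2 · 1`,
    Subalgebra.center (KTwo k) (CyclicAlg k m (θ : k) (tv k 0) (tv k 1)) = ⊥ ∧
    -- and it has dimension `m²` over `K_2`
    Module.Finite (KTwo k) (CyclicAlg k m (θ : k) (tv k 0) (tv k 1)) ∧
    Module.finrank (KTwo k) (CyclicAlg k m (θ : k) (tv k 0) (tv k 1)) = m ^ 2 := by
  have hord' : orderOf (algebraMap k (KTwo k) (θ : k)) = m := by
    rw [← hord, ← orderOf_units]
    exact orderOf_injective (algebraMap k (KTwo k)).toMonoidHom
      (algebraMap k (KTwo k)).injective _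
  have := nontrivial_cyclicAlg (u₁ := tv k 0) (u₂ := tv k 1) hm (hord ▸ pow_orderOf_eq_one θ)
  have hcomm := cyclicGen_comm (m := m) (u₁ := tv k 0) (u₂ := tv k 1) (θ : k)
  have hx := cyclicGen_zero_pow (m := m) (u₁ := tv k 0) (u₂ := tv k 1) (θ : k)
  have hy := cyclicGen_one_pow (m := m) (u₁ := tv k 0) (u₂ := tv k 1) (θ : k)
  have hgen := adjoin_cyclicGen (m := m) (u₁ := tv k 0) (u₂ := tv k 1) (θ : k)
  obtain ⟨hunit, hcenter, hfin, hrank⟩ :=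
    centralDivision_of_symbol (A := CyclicAlg k m (θ : k) (tv k 0) (tv k 1))
      hord' θ.ne_zero hcomm hm hx hy hgen
  exact ⟨this, hunit, hcenter, hfin, hrank⟩
end
end
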